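/- arXiv:2303.14454 — 6 statements merged into one kernel-verified Lean document; each statement's English description precedes it below -/
import Mathlib

section
/- Let all agents have matroid-rank valuations and let X = (X_1,…,X_n) be a non-redundant allocation. For agents i, j ∈ N, let Q = (g_1,…,g_t) be a shortest directed path in the exchange graph G(X) from the vertex set F_i(X_i) to the vertex set X_j (in particular g_1 ∈ F_i(X_i) and g_t ∈ X_j). Then: v_i((X_i △ Q) ∪ {g_1}) = |X_i| + 1; v_j(X_j ∖ {g_t}) = |X_j| − 1; and v_k(X_k △ Q) = |X_k| for every k ∈ N ∖ {i, j}. -/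
open Finset

/-- `v` is a matroid-rank (binary submodular) valuation on the ground set `M`:
binary marginal gains, monotone, submodular, and normalized. -/
def MatroidRank {γ : Type} [DecidableEq γ] (M : Finset γ) (v : Finset γ → ℕ) : Prop :=
  (∀ S ⊆ M, ∀ g ∈ M, g ∉ S → v (insert g S) = v S ∨ v (insert g S) = v S + 1) ∧
  (∀ S T : Finset γ, S ⊆ T → T ⊆ M → v S ≤ v T) ∧
  (∀ S T : Finset γ, S ⊆ T → T ⊆ M → ∀ g ∈ M, g ∉ T →
    v (insert g T) + v S ≤ v (insert g S) + v T) ∧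
  v ∅ = 0

/-- An allocation of (some of) the goods in `M` to `n` agents: pairwise disjoint bundles. -/
def IsAlloc {γ : Type} (n : ℕ) (M : Finset γ) (A : Fin n → Finset γ) : Prop :=
  (∀ i, A i ⊆ M) ∧ ∀ i j : Fin n, i ≠ j → Disjoint (A i) (A j)

/-- Non-redundancy: every agent's utility equals her bundle size. -/
def NonRedundant {γ : Type} (n : ℕ) (v : Fin n → Finset γ → ℕ) (A : Fin n → Finset γ) : Prop :=
  ∀ i, v i (A i) = (A i).card

/-- Pareto-optimality of an allocation. -/
def ParetoOptimal {γ : Type} (n : ℕ) (M : Finset γ) (v : Fin n → Finset γ → ℕ)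
    (A : Fin n → Finset γ) : Prop :=
  ¬ ∃ B : Fin n → Finset γ, IsAlloc n M B ∧ (∀ i, v i (A i) ≤ v i (B i)) ∧
      ∃ i, v i (A i) < v i (B i)

/-- The edge relation of the exchange graph of allocation `A` (vertex set `M`). -/
def ExEdge {γ : Type} [DecidableEq γ] (n : ℕ) (M : Finset γ) (v : Fin n → Finset γ → ℕ)
    (A : Fin n → Finset γ) (a b : γ) : Prop :=
  a ∈ M ∧ b ∈ M ∧ ∃ i, a ∈ A i ∧ b ∉ A i ∧ v i ((insert b (A i)).erase a) = v i (A i)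

/-- `FSet M v B g` : good `g ∈ M` lies outside `B` and adds marginal value `1` to `B`. -/
def FSet {γ : Type} [DecidableEq γ] (M : Finset γ) (v : Finset γ → ℕ) (B : Finset γ)
    (g : γ) : Prop :=
  g ∈ M ∧ g ∉ B ∧ v (insert g B) = v B + 1

namespace PathAug

variable {γ : Type} [DecidableEq γ] {M : Finset γ} {v : Finset γ → ℕ}

lemma mono (hv : MatroidRank M v) {S T : Finset γ} (h : S ⊆ T) (hT : T ⊆ M) : v S ≤ v T :=
  hv.2.1 S T h hT

lemma sm_aux (hv : MatroidRank M v) {A B : Finset γ} (hAB : A ⊆ B) (hB : B ⊆ M)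
    (C : Finset γ) : C ⊆ M → v (B ∪ C) + v A ≤ v (A ∪ C) + v B := by
  induction C using Finset.induction_on with
  | empty => intro _; simp [add_comm]
  | insert g C hg ih =>
    intro hC
    have hgM : g ∈ M := hC (mem_insert_self _ _)
    have hCM : C ⊆ M := fun x hx => hC (mem_insert_of_mem hx)
    have ih := ih hCM
    rw [union_insert, union_insert]
    by_cases hgB : g ∈ B ∪ C
    · rw [insert_eq_of_mem hgB]
      have := mono hv (subset_insert g (A ∪ C))
        (insert_subset hgM (union_subset (hAB.trans hB) hCM))
      omega
    · have := hv.2.2.1 (A ∪ C) (B ∪ C) (union_subset_union_left hAB) (union_subset hB hCM) g hgM hgB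
      omega

lemma sm (hv : MatroidRank M v) {A B : Finset γ} (hA : A ⊆ M) (hB : B ⊆ M) :
    v (A ∪ B) + v (A ∩ B) ≤ v A + v B := by
  have h := sm_aux hv (A := A ∩ B) (B := B) inter_subset_right hB A hA
  have h1 : A ∩ B ∪ A = A := by grind
  rw [h1, union_comm] at h
  exact h

lemma card_le (hv : MatroidRank M v) (S : Finset γ) : S ⊆ M → v S ≤ S.card := by
  induction S using Finset.induction_on with
  | empty => intro _; simp [hv.2.2.2]
  | insert g C hg ih =>
    intro hC
    have hgM : g ∈ M := hC (mem_insert_self _ _)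
    have hCM : C ⊆ M := fun x hx => hC (mem_insert_of_mem hx)
    have ih := ih hCM
    rw [card_insert_of_notMem hg]
    rcases hv.1 C hCM g hgM hg with h | h <;> omega

lemma insert_le (hv : MatroidRank M v) {S : Finset γ} (hS : S ⊆ M) {g : γ} (hg : g ∈ M) :
    v (insert g S) ≤ v S + 1 := by
  by_cases h : g ∈ S
  · rw [insert_eq_of_mem h]; omega
  · rcases hv.1 S hS g hg h with h | h <;> omega

lemma indep_subset (hv : MatroidRank M v) {S B : Finset γ} (hS : S ⊆ B) (hB : B ⊆ M)
    (h : v B = B.card) : v S = S.card := by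
  have h1 := sm hv (hS.trans hB) (sdiff_subset.trans hB : B \ S ⊆ M)
  rw [union_sdiff_of_subset hS] at h1
  have h2 := card_le hv (B \ S) (sdiff_subset.trans hB)
  have h3 := card_le hv S (hS.trans hB)
  have h4 := card_sdiff_add_card_eq_card hS
  omega

lemma span_inter (hv : MatroidRank M v) {B : Finset γ} (hB : B ⊆ M) (hI : v B = B.card)
    {z : γ} (hz : z ∈ M) (h0 : v (insert z B) ≤ B.card) (Y : Finset γ) :
    Y ⊆ B → (∀ y ∈ Y, v (insert z (B.erase y)) < B.card) →
    v (insert z (B \ Y)) ≤ (B \ Y).card := by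
  induction Y using Finset.induction_on with
  | empty => intro _ _; simpa using h0
  | insert a Y ha ih =>
    intro hY hd
    have haB : a ∈ B := hY (mem_insert_self _ _)
    have ih := ih (fun x hx => hY (mem_insert_of_mem hx)) (fun y hy => hd y (mem_insert_of_mem hy))
    have hda := hd a (mem_insert_self _ _)
    have hS : B \ Y ⊆ B := sdiff_subset
    have hT : B.erase a ⊆ B := erase_subset _ _
    have h1 := sm hv (A := insert z (B \ Y)) (B := insert z (B.erase a))
      (insert_subset hz (hS.trans hB)) (insert_subset hz (hT.trans hB))
    have e1 : insert z (B \ Y) ∩ insert z (B.erase a) = insert z (B \ insert a Y) := by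
      ext x; simp only [mem_inter, mem_insert, mem_sdiff, mem_erase]; tauto
    have e2 : (B \ Y) ∩ (B.erase a) = B \ insert a Y := by
      ext x; simp only [mem_inter, mem_insert, mem_sdiff, mem_erase]; tauto
    have hU : (B \ Y) ∪ (B.erase a) ⊆ B := union_subset hS hT
    have h2 := indep_subset hv hU hB hI
    have h3 : v ((B \ Y) ∪ (B.erase a)) ≤ v (insert z (B \ Y) ∪ insert z (B.erase a)) := by
      apply mono hv
      · exact union_subset_union (subset_insert _ _) (subset_insert _ _)
      · exact union_subset (insert_subset hz (hS.trans hB)) (insert_subset hz (hT.trans hB))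
    have h4 := card_union_add_card_inter (B \ Y) (B.erase a)
    have h5 := card_erase_add_one haB
    rw [e1] at h1
    rw [e2] at h4
    omega

lemma core (hv : MatroidRank M v) {B : Finset γ} (hB : B ⊆ M) (hI : v B = B.card)
    (L : List (γ × γ)) :
    (∀ p ∈ L, p.1 ∈ B ∧ p.2 ∈ M ∧ p.2 ∉ B ∧ v (insert p.2 (B.erase p.1)) = B.card) →
    L.Pairwise (fun p q => v (insert q.2 (B.erase p.1)) < B.card) →
    v ((B \ (L.map Prod.fst).toFinset) ∪ (L.map Prod.snd).toFinset) = B.card ∧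
    ((B \ (L.map Prod.fst).toFinset) ∪ (L.map Prod.snd).toFinset).card ≤ B.card := by
  induction L using List.reverseRecOn with
  | nil => intro _ _; simp [hI]
  | append_singleton L p ih =>
    intro h1 h2
    rw [List.pairwise_append] at h2
    obtain ⟨h2, -, h3⟩ := h2
    obtain ⟨ihv, ihc⟩ := ih (fun q hq => h1 q (by simp [hq])) h2
    obtain ⟨y, z⟩ := p
    obtain ⟨hy, hz, hzB, hyz⟩ := h1 (y, z) (by simp)
    simp only at hy hz hzB hyz
    have h3 : ∀ q ∈ L, v (insert z (B.erase q.1)) < B.card := fun q hq => h3 q hq (y, z) (by simp)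
    have hY : ∀ a ∈ (L.map Prod.fst).toFinset, v (insert z (B.erase a)) < B.card := by
      intro a ha
      simp only [List.mem_toFinset, List.mem_map] at ha
      obtain ⟨q, hq, rfl⟩ := ha
      exact h3 q hq
    have hYB : (L.map Prod.fst).toFinset ⊆ B := by
      intro a ha
      simp only [List.mem_toFinset, List.mem_map] at ha
      obtain ⟨q, hq, rfl⟩ := ha
      exact (h1 q (by simp [hq])).1
    have hZ : ∀ a ∈ (L.map Prod.snd).toFinset, a ∈ M ∧ a ∉ B := by
      intro a ha
      simp only [List.mem_toFinset, List.mem_map] at ha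
      obtain ⟨q, hq, rfl⟩ := ha
      have := h1 q (by simp [hq])
      exact ⟨this.2.1, this.2.2.1⟩
    have hyY : y ∉ (L.map Prod.fst).toFinset := fun h => by have := hY y h; omega
    have eY : ((L ++ [(y, z)]).map Prod.fst).toFinset = insert y (L.map Prod.fst).toFinset := by
      ext x; simp
    have eZ : ((L ++ [(y, z)]).map Prod.snd).toFinset = insert z (L.map Prod.snd).toFinset := by
      ext x; simp
    have eL : L = [] ∨ (L.map Prod.fst).toFinset.Nonempty := by
      cases L with
      | nil => simp
      | cons a l => right; exact ⟨a.1, by simp⟩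
    rw [eY, eZ]
    have hnil : L = [] → (L.map Prod.fst).toFinset = ∅ ∧ (L.map Prod.snd).toFinset = ∅ := by
      rintro rfl; simp
    generalize (L.map Prod.fst).toFinset = Y at *
    generalize (L.map Prod.snd).toFinset = Z at *
    have eD : B \ insert y Y ∪ insert z Z = insert z ((B \ Y ∪ Z).erase y) := by
      ext x
      simp only [mem_union, mem_sdiff, mem_insert, mem_erase]
      have := hZ x
      constructor
      · rintro (h | h | h)
        · tauto
        · tauto
        · right
          refine ⟨?_, Or.inr h⟩
          rintro rfl; exact (hZ x h).2 hy
      · tauto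
    rw [eD]
    have hyD : y ∈ B \ Y ∪ Z := by simp [hy, hyY]
    have hDM : B \ Y ∪ Z ⊆ M := union_subset (sdiff_subset.trans hB) (fun a ha => (hZ a ha).1)
    have hD'M : insert z ((B \ Y ∪ Z).erase y) ⊆ M :=
      insert_subset hz ((erase_subset _ _).trans hDM)
    have hc : (insert z ((B \ Y ∪ Z).erase y)).card ≤ B.card := by
      have := card_insert_le z ((B \ Y ∪ Z).erase y)
      have := card_erase_add_one hyD
      omega
    refine ⟨?_, hc⟩
    have hub := card_le hv _ hD'M
    rcases eL with h | ⟨a, ha⟩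
    · obtain ⟨rfl, rfl⟩ := hnil h
      simpa using hyz
    have h0 : v (insert z B) ≤ B.card := by
      have haB := hYB ha
      have := hY a ha
      have h5 := insert_le hv (S := insert z (B.erase a)) (g := a)
        (insert_subset hz ((erase_subset _ _).trans hB)) (hB haB)
      have : insert a (insert z (B.erase a)) = insert z B := by
        rw [Finset.insert_comm, insert_erase haB]
      rw [this] at h5
      omega
    have hE := span_inter hv hB hI hz h0 Y hYB hY
    have hEM : insert z (B \ Y) ⊆ M := insert_subset hz (sdiff_subset.trans hB)
    have hs := sm hv hEM hD'M
    have hcz : (insert z (B.erase y)).card = B.card := by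
      rw [card_insert_of_notMem (by simp [hzB]), card_erase_add_one hy]
    have hi := indep_subset hv (S := insert z ((B \ Y).erase y)) (B := insert z (B.erase y))
      (insert_subset_insert _ (erase_subset_erase _ sdiff_subset))
      (insert_subset hz ((erase_subset _ _).trans hB)) (by rw [hyz, hcz])
    rw [card_insert_of_notMem (by simp [hzB]), card_erase_add_one (by simp [hy, hyY])] at hi
    have hm1 : v (insert z ((B \ Y).erase y)) ≤
        v (insert z (B \ Y) ∩ insert z ((B \ Y ∪ Z).erase y)) := by
      apply mono hv
      · clear * -
        intro x
        simp only [mem_inter, mem_insert, mem_erase, mem_union]; tauto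
      · exact inter_subset_left.trans hEM
    have hm2 : v (B \ Y ∪ Z) ≤ v (insert z (B \ Y) ∪ insert z ((B \ Y ∪ Z).erase y)) := by
      apply mono hv
      · intro x
        simp only [mem_insert, mem_erase, mem_union, mem_sdiff]
        intro h
        by_cases hx : x = y
        · exact Or.inl (Or.inr ⟨hx ▸ hy, hx ▸ hyY⟩)
        · exact Or.inr (Or.inr ⟨hx, h⟩)
      · exact union_subset hEM hD'M
    omega

lemma pairs_pairwise {γ : Type} {Q : List γ} {R : γ → γ → Prop}
    (h : ∀ a b (hab : a < b) (hb : b + 1 < Q.length), R Q[a] Q[b + 1]) :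
    (Q.zip Q.tail).Pairwise (fun p q => R p.1 q.2) := by
  rw [List.pairwise_iff_getElem]
  intro a b ha hb hab
  simp only [List.length_zip, List.length_tail] at ha hb
  simp only [List.getElem_zip, List.getElem_tail]
  exact h a b hab (by omega)

end PathAug

/-- Path augmentation `B △ P`: for each consecutive pair `(gⱼ, gⱼ₊₁)` of the path `P`
with `gⱼ ∈ B`, remove `gⱼ` and add `gⱼ₊₁`. -/
def augmentPath {γ : Type} [DecidableEq γ] (B : Finset γ) (P : List γ) : Finset γ :=
  (B \ (((P.zip P.tail).filter fun p => p.1 ∈ B).map Prod.fst).toFinset) ∪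
    (((P.zip P.tail).filter fun p => p.1 ∈ B).map Prod.snd).toFinset

/-- The weighted welfare `∑ i, wᵢ · f(vᵢ(Aᵢ))`. -/
noncomputable def Welfare {γ : Type} (n : ℕ) (w : Fin n → ℝ) (v : Fin n → Finset γ → ℕ)
    (f : ℕ → EReal) (A : Fin n → Finset γ) : EReal :=
  ∑ i, (w i : EReal) * f (v i (A i))

/-- The set of agents receiving positive utility. -/
def PosAgents {γ : Type} (n : ℕ) (v : Fin n → Finset γ → ℕ) (A : Fin n → Finset γ) :
    Finset (Fin n) :=
  Finset.univ.filter fun i => 0 < v i (A i)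

/-- The weighted welfare restricted to the positively-served agents. -/
noncomputable def RWelfare {γ : Type} (n : ℕ) (w : Fin n → ℝ) (v : Fin n → Finset γ → ℕ)
    (f : ℕ → EReal) (A : Fin n → Finset γ) : EReal :=
  ∑ i ∈ PosAgents n v A, (w i : EReal) * f (v i (A i))

/-- `S` is lexicographically preferred to `T` (favoring lower indices), strictly. -/
def LexLt {n : ℕ} (S T : Finset (Fin n)) : Prop :=
  ∃ i, i ∈ S ∧ i ∉ T ∧ ∀ j, j < i → (j ∈ S ↔ j ∈ T)

/-- `S` is lexicographically weakly preferred to `T` (favoring lower indices). -/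
def LexLE {n : ℕ} (S T : Finset (Fin n)) : Prop := S = T ∨ LexLt S T

/-- `A` is an `R_f` allocation: it maximizes the weighted welfare; if the maximum welfare
is `-∞`, it first maximizes the number of positively-served agents (breaking ties between
the sets of positively-served agents lexicographically in favor of lower indices), and then
maximizes the weighted welfare over the positively-served agents. -/
def IsRf {γ : Type} (n : ℕ) (M : Finset γ) (w : Fin n → ℝ) (v : Fin n → Finset γ → ℕ)
    (f : ℕ → EReal) (A : Fin n → Finset γ) : Prop :=
  IsAlloc n M A ∧
  ((∃ B, IsAlloc n M B ∧ Welfare n w v f B ≠ ⊥) →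
    ∀ B, IsAlloc n M B → Welfare n w v f B ≤ Welfare n w v f A) ∧
  ((∀ B, IsAlloc n M B → Welfare n w v f B = ⊥) →
    ∀ B, IsAlloc n M B →
      ((PosAgents n v B).card < (PosAgents n v A).card ∨
        ((PosAgents n v B).card = (PosAgents n v A).card ∧
          LexLE (PosAgents n v A) (PosAgents n v B))) ∧
      (PosAgents n v B = PosAgents n v A → RWelfare n w v f B ≤ RWelfare n w v f A))

/-- Strict lexicographic order on utility vectors. -/
def VecLexLt (n : ℕ) (u u' : Fin n → ℕ) : Prop :=
  ∃ i, u i < u' i ∧ ∀ j, j < i → u j = u' j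

/-- `A` is an `R^tie_f` allocation: an `R_f` allocation that is lexicographically dominating
within the set of `R_f` allocations and non-redundant. -/
def IsRfTie {γ : Type} (n : ℕ) (M : Finset γ) (w : Fin n → ℝ) (v : Fin n → Finset γ → ℕ)
    (f : ℕ → EReal) (A : Fin n → Finset γ) : Prop :=
  IsRf n M w v f A ∧
  (∀ B, IsRf n M w v f B → ¬ VecLexLt n (fun i => v i (A i)) (fun i => v i (B i))) ∧
  NonRedundant n v A

/-- Path augmentation along a shortest exchange-graph path `Q` from `F_i(X_i)` to `X_j`
increases agent `i`'s utility by one (after adding the first good), decreases agent `j`'s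
utility by one (after removing the last good), and preserves everyone else's utility. -/
theorem pathAugmentation {γ : Type} [DecidableEq γ] {n : ℕ} (M : Finset γ)
    (v : Fin n → Finset γ → ℕ) (hv : ∀ i, MatroidRank M (v i))
    (X : Fin n → Finset γ) (hX : IsAlloc n M X) (hXnr : NonRedundant n v X)
    (i j : Fin n) (hij : i ≠ j) (Q : List γ) (g1 gt : γ)
    (hchain : Q.Chain' (ExEdge n M v X))
    (hhead : Q.head? = some g1) (hlast : Q.getLast? = some gt)
    (hg1 : FSet M (v i) (X i) g1) (hgt : gt ∈ X j)
    (hshort : ∀ Q' : List γ, Q'.Chain' (ExEdge n M v X) →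
      (∃ a, Q'.head? = some a ∧ FSet M (v i) (X i) a) →
      (∃ b, Q'.getLast? = some b ∧ b ∈ X j) →
      Q.length ≤ Q'.length) :
    v i (insert g1 (augmentPath (X i) Q)) = (X i).card + 1 ∧
    v j ((X j).erase gt) + 1 = (X j).card ∧
    ∀ k : Fin n, k ≠ i → k ≠ j → v k (augmentPath (X k) Q) = (X k).card := by
  obtain ⟨hXM, hXd⟩ := hX
  have hlast' : ∀ a, a < Q.length → (Q.drop a).getLast? = some gt := by
    intro a ha
    rw [List.getLast?_drop, if_neg (by omega), hlast]
  -- no shortcuts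
  have hnosc : ∀ a b (hab : a < b) (hb : b + 1 < Q.length), ¬ ExEdge n M v X Q[a] Q[b + 1] := by
    intro a b hab hb he
    have := hshort (Q.take (a + 1) ++ Q.drop (b + 1)) ?_ ⟨g1, ?_, hg1⟩ ⟨gt, ?_, hgt⟩
    · simp at this; omega
    · refine List.IsChain.append (hchain.take _) (hchain.drop _) ?_
      intro x hx y hy
      rw [List.getLast?_take] at hx
      simp [List.getElem?_eq_getElem (show a < Q.length by omega)] at hx
      simp [List.head?_drop, List.getElem?_eq_getElem hb] at hy
      subst hx hy
      exact he
    · rw [List.head?_append, List.head?_take, if_neg (by omega), hhead]; rfl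
    · rw [List.getLast?_append, hlast' _ hb]; rfl
  -- later vertices are not in `F_i`
  have hnoF : ∀ a (ha : a + 1 < Q.length), ¬ FSet M (v i) (X i) Q[a + 1] := by
    intro a ha hF
    have := hshort (Q.drop (a + 1)) (hchain.drop _)
      ⟨Q[a + 1], by simp [List.head?_drop, List.getElem?_eq_getElem ha], hF⟩
      ⟨gt, hlast' _ ha, hgt⟩
    simp at this; omega
  have hpw : (Q.zip Q.tail).Pairwise (fun p q => ¬ ExEdge n M v X p.1 q.2) :=
    PathAug.pairs_pairwise (R := fun a b => ¬ ExEdge n M v X a b) hnosc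
  have hpe : ∀ p ∈ Q.zip Q.tail, ExEdge n M v X p.1 p.2 ∧ ¬ FSet M (v i) (X i) p.2 := by
    intro p hp
    obtain ⟨a, ha, rfl⟩ := List.getElem_of_mem hp
    simp only [List.length_zip, List.length_tail] at ha
    simp only [List.getElem_zip, List.getElem_tail]
    exact ⟨List.isChain_iff_getElem.mp hchain a (by omega), hnoF a (by omega)⟩
  -- properties of the pairs of agent `k`
  have hA : ∀ k, ∀ p ∈ (Q.zip Q.tail).filter (fun p => p.1 ∈ X k),
      p.1 ∈ X k ∧ p.2 ∈ M ∧ p.2 ∉ X k ∧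
        v k (insert p.2 ((X k).erase p.1)) = (X k).card := by
    intro k p hp
    simp only [List.mem_filter, decide_eq_true_eq] at hp
    obtain ⟨hp, hk⟩ := hp
    obtain ⟨⟨-, h2, k', hk', h3, h4⟩, -⟩ := hpe p hp
    have : k' = k := by
      by_contra hne
      exact disjoint_left.mp (hXd k' k hne) hk' hk
    subst this
    refine ⟨hk, h2, h3, ?_⟩
    rw [← hXnr, ← h4, erase_insert_of_ne]
    rintro h; rw [h] at h3; exact h3 hk
  have hB : ∀ k, ((Q.zip Q.tail).filter (fun p => p.1 ∈ X k)).Pairwise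
      (fun p q => v k (insert q.2 ((X k).erase p.1)) < (X k).card) := by
    intro k
    refine List.Pairwise.imp_of_mem ?_ (hpw.filter _)
    intro p q hp hq hne
    obtain ⟨hp1, -, -, -⟩ := hA k p hp
    obtain ⟨-, hq2, hq3, -⟩ := hA k q hq
    have hle := PathAug.card_le (hv k) (insert q.2 ((X k).erase p.1))
      (insert_subset hq2 ((erase_subset _ _).trans (hXM k)))
    rw [card_insert_of_notMem (by simp [hq3]), card_erase_add_one hp1] at hle
    refine lt_of_le_of_ne hle ?_
    intro heq
    apply hne
    refine ⟨hXM k hp1, hq2, k, hp1, hq3, ?_⟩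
    rw [hXnr, ← heq, erase_insert_of_ne]
    rintro h; rw [h] at hq3; exact hq3 hp1
  refine ⟨?_, ?_, ?_⟩
  · obtain ⟨hgM, hgX, hgv⟩ := hg1
    have hcg : (insert g1 (X i)).card = (X i).card + 1 := card_insert_of_notMem hgX
    have hIM : insert g1 (X i) ⊆ M := insert_subset hgM (hXM i)
    have hI : v i (insert g1 (X i)) = (insert g1 (X i)).card := by rw [hgv, hcg, hXnr]
    have hz : ∀ p ∈ (Q.zip Q.tail).filter (fun p => p.1 ∈ X i),
        v i (insert p.2 (X i)) = (X i).card ∧ p.2 ≠ g1 := by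
      intro p hp
      obtain ⟨-, h2, h3, -⟩ := hA i p hp
      have hF := (hpe p (List.mem_of_mem_filter hp)).2
      constructor
      · rcases (hv i).1 (X i) (hXM i) p.2 h2 h3 with h | h
        · rw [h, hXnr]
        · exact absurd ⟨h2, h3, h⟩ hF
      · intro h
        apply hF
        rw [h]
        exact ⟨hgM, hgX, hgv⟩
    have hcore := (PathAug.core (hv i) hIM hI ((Q.zip Q.tail).filter (fun p => p.1 ∈ X i))
      ?_ ?_).1
    · rw [← hcg, ← hcore]
      congr 1
      unfold augmentPath
      have hgY : g1 ∉ (((Q.zip Q.tail).filter fun p => p.1 ∈ X i).map Prod.fst).toFinset := by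
        intro h
        simp only [List.mem_toFinset, List.mem_map] at h
        obtain ⟨q, hq, h⟩ := h
        exact hgX (h ▸ (hA i q hq).1)
      rw [insert_sdiff_of_notMem _ hgY, insert_union]
    · intro p hp
      obtain ⟨h1, h2, h3, h4⟩ := hA i p hp
      obtain ⟨h5, h6⟩ := hz p hp
      refine ⟨mem_insert_of_mem h1, h2, by simp [h3, h6], ?_⟩
      have hne : p.1 ≠ g1 := fun h => hgX (h ▸ h1)
      have hDM : insert p.2 ((insert g1 (X i)).erase p.1) ⊆ M :=
        insert_subset h2 ((erase_subset _ _).trans hIM)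
      have hEM : insert p.2 (X i) ⊆ M := insert_subset h2 (hXM i)
      apply le_antisymm
      · have := PathAug.card_le (hv i) _ hDM
        rwa [card_insert_of_notMem (by simp [h3, h6]),
          card_erase_add_one (mem_insert_of_mem h1)] at this
      · have hs := PathAug.sm (hv i) hEM hDM
        have m1 : v i (insert p.2 ((X i).erase p.1)) ≤
            v i (insert p.2 (X i) ∩ insert p.2 ((insert g1 (X i)).erase p.1)) := by
          apply PathAug.mono (hv i)
          · intro x
            simp only [mem_inter, mem_insert, mem_erase]; tauto
          · exact inter_subset_left.trans hEM
        have m2 : v i (insert g1 (X i)) ≤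
            v i (insert p.2 (X i) ∪ insert p.2 ((insert g1 (X i)).erase p.1)) := by
          apply PathAug.mono (hv i)
          · intro x
            simp only [mem_union, mem_insert, mem_erase]
            rintro (h | h)
            · subst h; exact Or.inr (Or.inr ⟨fun h => hne h.symm, Or.inl rfl⟩)
            · tauto
          · exact union_subset hEM hDM
        omega
    · refine List.Pairwise.imp_of_mem ?_ (hB i)
      intro p q hp hq hlt
      obtain ⟨h1, -, -, -⟩ := hA i p hp
      obtain ⟨-, h2, h3, -⟩ := hA i q hq
      have hne : p.1 ≠ g1 := fun h => hgX (h ▸ h1)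
      have := PathAug.insert_le (hv i) (S := insert q.2 ((X i).erase p.1)) (g := g1)
        (insert_subset h2 ((erase_subset _ _).trans (hXM i))) hgM
      rw [erase_insert_of_ne hne.symm, Finset.insert_comm, hcg]
      omega
  · rw [PathAug.indep_subset (hv j) (erase_subset gt (X j)) (hXM j) (hXnr j),
      card_erase_add_one hgt]
  · intro k _ _
    exact (PathAug.core (hv k) (hXM k) (hXnr k) _ (hA k) (hB k)).1
end

section
/- Let all agents have matroid-rank valuations, let X = (X_1,…,X_n) be a non-redundant allocation, and let A = (A_1,…,A_n) be a Pareto-optimal non-redundant allocation such that there exists an agent h ∈ H(X, A). Then there exists an agent ℓ ∈ L(X, A) such that: (1) there is a non-redundant allocation Y with |Y_ℓ| = |X_ℓ| + 1, |Y_h| = |X_h| − 1, and |Y_k| = |X_k| for all k ∈ N ∖ {ℓ, h}; and (2) there is a non-redundant allocation B with |B_ℓ| = |A_ℓ| − 1, |B_h| = |A_h| + 1, and |B_k| = |A_k| for all k ∈ N ∖ {ℓ, h}. -/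
open Finset

/-- Symmetric basis exchange. -/
theorem symmExch {α : Type*} (U : Matroid α) {B C : Set α} (hB : U.IsBase B) (hC : U.IsBase C)
    {e : α} (heC : e ∈ C) (heB : e ∉ B) :
    ∃ f ∈ B, f ∉ C ∧ U.Indep (insert f (C \ {e})) ∧ U.Indep (insert e B \ {f}) := by
  by_contra hcon
  push Not at hcon
  have heE : e ∈ U.E := hC.subset_ground heC
  have hecl : e ∈ U.closure B := by rwa [hB.closure_eq]
  have hcirc := hB.fundCircuit_isCircuit heE heB
  have h1 := hcirc.mem_closure_sdiff_singleton_of_mem (U.mem_fundCircuit e B)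
  have hCi : U.Indep (C \ {e}) := hC.indep.sdiff _
  have hsub : U.fundCircuit e B \ {e} ⊆ U.closure (C \ {e}) := by
    rintro f ⟨hf, hfe⟩
    have hfB : f ∈ B := by
      have := U.fundCircuit_subset_insert e B hf
      rcases this with h | h
      · exact absurd h hfe
      · exact h
    have hfi := (hB.indep.mem_fundCircuit_iff hecl heB).1 hf
    by_cases hfC : f ∈ C
    · exact U.subset_closure (C \ {e}) hCi.subset_ground ⟨hfC, hfe⟩
    · by_contra hncl
      refine hcon f hfB hfC ?_ hfi
      exact hCi.insert_indep_iff.2 (Or.inl ⟨hB.subset_ground hfB, hncl⟩)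
  have h2 := U.closure_subset_closure_of_subset_closure hsub h1
  exact hC.indep.notMem_closure_sdiff_of_mem heC h2

section MR
variable {γ : Type} [DecidableEq γ] {M : Finset γ} {v : Finset γ → ℕ}

theorem mr_union_le (hv : MatroidRank M v) (S T : Finset γ) (hS : S ⊆ M) (hT : T ⊆ M) :
    v (S ∪ T) ≤ v S + T.card := by
  induction T using Finset.induction_on with
  | empty => simp
  | insert g T hg ih =>
    have hgM : g ∈ M := hT (Finset.mem_insert_self _ _)
    have hTM : T ⊆ M := fun x hx => hT (Finset.mem_insert_of_mem hx)
    have := ih hTM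
    rw [Finset.union_insert, Finset.card_insert_of_notMem hg]
    by_cases hgU : g ∈ S ∪ T
    · rw [Finset.insert_eq_of_mem hgU]; omega
    · rcases hv.1 (S ∪ T) (Finset.union_subset hS hTM) g hgM hgU with h | h <;> omega

theorem mr_subset (hv : MatroidRank M v) (S T : Finset γ) (hST : S ⊆ T) (hT : T ⊆ M)
    (h : v T = T.card) : v S = S.card := by
  have h1 := mr_union_le hv S (T \ S) (hST.trans hT) (Finset.sdiff_subset.trans hT)
  have h2 := mr_union_le hv ∅ S (by simp) (hST.trans hT)
  rw [Finset.union_sdiff_of_subset hST] at h1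
  rw [Finset.empty_union, hv.2.2.2] at h2
  have h3 := Finset.card_sdiff_add_card_eq_card hST
  omega

theorem mr_aug (hv : MatroidRank M v) (S T : Finset γ) (hS : S ⊆ M) (hT : T ⊆ M)
    (h1 : v S = S.card) (h2 : v T = T.card) (hlt : S.card < T.card) :
    ∃ g ∈ T, g ∉ S ∧ v (insert g S) = (insert g S).card := by
  by_contra hcon
  push Not at hcon
  have key : ∀ R ⊆ T, v (S ∪ R) = v S := by
    intro R
    induction R using Finset.induction_on with
    | empty => simp
    | insert g R hg ih =>
      intro hR
      have hgT : g ∈ T := hR (Finset.mem_insert_self _ _)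
      have hRT : R ⊆ T := fun x hx => hR (Finset.mem_insert_of_mem hx)
      have ih := ih hRT
      rw [Finset.union_insert]
      by_cases hgU : g ∈ S ∪ R
      · rw [Finset.insert_eq_of_mem hgU]; exact ih
      · have hgS : g ∉ S := fun h => hgU (Finset.mem_union_left _ h)
        have hU : S ∪ R ⊆ M := Finset.union_subset hS (hRT.trans hT)
        have h3 := hcon g hgT hgS
        rw [Finset.card_insert_of_notMem hgS] at h3
        have h4 := hv.1 S hS g (hT hgT) hgS
        have h5 := hv.2.2.1 S (S ∪ R) Finset.subset_union_left hU g (hT hgT) hgU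
        have h6 := hv.1 (S ∪ R) hU g (hT hgT) hgU
        omega
  have h3 := key T subset_rfl
  have h4 := hv.2.1 T (S ∪ T) Finset.subset_union_right (Finset.union_subset hS hT)
  omega

end MR

/-- The agent owning a slot. -/
def ownr {γ : Type} {n m : ℕ} (z : γ ⊕ (Fin n × Fin m)) : Option (Fin n) :=
  Sum.elim (fun _ => none) (fun p => some p.1) z

/-- Slots of agent `i` in `F`. -/
def slts {γ : Type} {n m : ℕ} (i : Fin n) (F : Finset (γ ⊕ (Fin n × Fin m))) :
    Finset (γ ⊕ (Fin n × Fin m)) := F.filter (fun z => ownr z = some i)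

theorem mem_slts_inl {γ : Type} {n m : ℕ} (i : Fin n) (F : Finset (γ ⊕ (Fin n × Fin m))) (g : γ) :
    Sum.inl g ∈ slts i F ↔ False := by
  rw [slts, Finset.mem_filter]; simp [ownr]

theorem mem_slts_inr {γ : Type} {n m : ℕ} (i k : Fin n) (j : Fin m)
    (F : Finset (γ ⊕ (Fin n × Fin m))) :
    Sum.inr (k, j) ∈ slts i F ↔ Sum.inr (k, j) ∈ F ∧ k = i := by
  rw [slts, Finset.mem_filter]; simp [ownr]

/-- `J` is a witness of independence of `F`. -/
def Wit {γ : Type} {n m : ℕ} (M : Finset γ) (v : Fin n → Finset γ → ℕ)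
    (F : Finset (γ ⊕ (Fin n × Fin m))) (J : Fin n → Finset γ) : Prop :=
  IsAlloc n M J ∧ NonRedundant n v J ∧ (∀ g, Sum.inl g ∈ F ↔ ∃ i, g ∈ J i) ∧
    ∀ i, (J i).card + (slts i F).card ≤ m

theorem wit_card {γ : Type} [DecidableEq γ] {n m : ℕ} {M : Finset γ} {v : Fin n → Finset γ → ℕ}
    {F : Finset (γ ⊕ (Fin n × Fin m))} {J : Fin n → Finset γ} (h : Wit M v F J) :
    F.card = ∑ i, ((J i).card + (slts i F).card) := by
  have hF : F = Finset.univ.biUnion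
      (fun i => (J i).map Function.Embedding.inl ∪ slts i F) := by
    ext z
    rcases z with g | ⟨i, j⟩
    · simp [mem_slts_inl, h.2.2.1 g]
    · simp [mem_slts_inr]
  conv_lhs => rw [hF]
  rw [Finset.card_biUnion]
  · refine Finset.sum_congr rfl fun i _ => ?_
    rw [Finset.card_union_of_disjoint, Finset.card_map]
    rw [Finset.disjoint_left]
    rintro z hz
    simp only [Finset.mem_map] at hz
    obtain ⟨g, _, rfl⟩ := hz
    simp [mem_slts_inl]
  · intro i _ j _ hij
    rw [Function.onFun, Finset.disjoint_left]
    rintro (g | ⟨k, l⟩)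
    · simp only [mem_slts_inl, mem_slts_inr, Finset.mem_union, Finset.mem_map]
      have : g ∈ J i → g ∉ J j := fun hg => Finset.disjoint_left.1 (h.1.2 i j hij) hg
      simpa using this
    · simp only [mem_slts_inl, mem_slts_inr, Finset.mem_union, Finset.mem_map]
      simp
      grind

theorem slts_insert_inl {γ : Type} [DecidableEq γ] {n m : ℕ} (k : Fin n) (g : γ)
    (F : Finset (γ ⊕ (Fin n × Fin m))) : slts k (insert (Sum.inl g) F) = slts k F := by
  rw [slts, Finset.filter_insert, if_neg (by simp [ownr]), slts]

theorem slts_insert_ne {γ : Type} [DecidableEq γ] {n m : ℕ} {k i : Fin n} (j : Fin m)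
    (F : Finset (γ ⊕ (Fin n × Fin m))) (h : k ≠ i) :
    slts k (insert (Sum.inr (i, j)) F) = slts k F := by
  rw [slts, Finset.filter_insert, if_neg (by simpa [ownr] using h.symm), slts]

theorem slts_insert_same {γ : Type} [DecidableEq γ] {n m : ℕ} (i : Fin n) (j : Fin m)
    (F : Finset (γ ⊕ (Fin n × Fin m))) (h : Sum.inr (i, j) ∉ F) :
    (slts i (insert (Sum.inr (i, j)) F)).card = (slts i F).card + 1 := by
  rw [slts, Finset.filter_insert, if_pos (by simp [ownr]), Finset.card_insert_of_notMem, slts]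
  simp [h]

theorem wit_aug {γ : Type} [DecidableEq γ] {n m : ℕ} {M : Finset γ} {v : Fin n → Finset γ → ℕ}
    (hv : ∀ i, MatroidRank M (v i))
    {F F' : Finset (γ ⊕ (Fin n × Fin m))} {J' : Fin n → Finset γ}
    (h' : Wit M v F' J') (hlt : F.card < F'.card) (N : ℕ) :
    ∀ J, Wit M v F J → (∑ i, (J' i).card) < (∑ i, (J i ∩ J' i).card) + N →
    ∃ e ∈ F', e ∉ F ∧ ∃ K, Wit M v (insert e F) K := by
  induction N with
  | zero =>
    intro J h hN
    have : ∑ i, (J i ∩ J' i).card ≤ ∑ i, (J' i).card :=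
      Finset.sum_le_sum fun i _ => Finset.card_le_card Finset.inter_subset_right
    omega
  | succ N ih =>
    intro J h hN
    rw [wit_card h, wit_card h'] at hlt
    obtain ⟨i, _, hi⟩ := Finset.exists_lt_of_sum_lt hlt
    have hmi := h'.2.2.2 i
    by_cases hs : slts i F' ⊆ slts i F
    · have hc := Finset.card_le_card hs
      obtain ⟨g, hgJ', hgJ, hgv⟩ := mr_aug (hv i) (J i) (J' i) (h.1.1 i) (h'.1.1 i) (h.2.1 i)
        (h'.2.1 i) (by omega)
      have hgM : g ∈ M := h'.1.1 i hgJ'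
      set K : Fin n → Finset γ := fun k => if k = i then insert g (J i) else (J k).erase g with hK
      have hKi : K i = insert g (J i) := by simp [hK]
      have hKk : ∀ k, k ≠ i → K k = (J k).erase g := fun k hk => by simp [hK, hk]
      have hKw : Wit M v (insert (Sum.inl g) F) K := by
        refine ⟨⟨?_, ?_⟩, ?_, ?_, ?_⟩
        · intro k
          by_cases hk : k = i
          · subst hk; rw [hKi]; exact Finset.insert_subset hgM (h.1.1 k)
          · rw [hKk k hk]; exact (Finset.erase_subset _ _).trans (h.1.1 k)
        · intro a b hab
          have hd := Finset.disjoint_left.1 (h.1.2 a b hab)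
          rw [Finset.disjoint_left]
          intro x
          by_cases ha : a = i
          · subst ha; rw [hKi, hKk b (Ne.symm hab)]
            have := @hd x
            grind
          · by_cases hb : b = i
            · subst hb; rw [hKi, hKk a ha]
              have := @hd x
              grind
            · rw [hKk a ha, hKk b hb]
              have := @hd x
              grind
        · intro k
          by_cases hk : k = i
          · subst hk; rw [hKi]; exact hgv
          · rw [hKk k hk]
            exact mr_subset (hv k) _ (J k) (Finset.erase_subset _ _) (h.1.1 k) (h.2.1 k)
        · intro x
          rw [Finset.mem_insert, h.2.2.1 x]
          constructor
          · rintro (hx | ⟨k, hk⟩)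
            · obtain rfl : x = g := by simpa using hx
              exact ⟨i, by rw [hKi]; simp⟩
            · by_cases hxg : x = g
              · exact ⟨i, by rw [hKi, hxg]; simp⟩
              · refine ⟨k, ?_⟩
                by_cases hki : k = i
                · subst hki; rw [hKi]; exact Finset.mem_insert_of_mem hk
                · rw [hKk k hki]; exact Finset.mem_erase.2 ⟨hxg, hk⟩
          · rintro ⟨k, hk⟩
            by_cases hki : k = i
            · subst hki; rw [hKi, Finset.mem_insert] at hk
              rcases hk with hk | hk
              · left; rw [hk]
              · exact Or.inr ⟨k, hk⟩
            · rw [hKk k hki] at hk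
              exact Or.inr ⟨k, Finset.mem_of_mem_erase hk⟩
        · intro k
          rw [slts_insert_inl]
          by_cases hki : k = i
          · subst hki; rw [hKi, Finset.card_insert_of_notMem hgJ]; omega
          · rw [hKk k hki]
            have h1 := Finset.card_le_card (Finset.erase_subset g (J k))
            have h2 := h.2.2.2 k
            omega
      by_cases hgF : Sum.inl g ∈ F
      · rw [Finset.insert_eq_of_mem hgF] at hKw
        refine ih K hKw ?_
        have : ∑ k, (J k ∩ J' k).card < ∑ k, (K k ∩ J' k).card := by
          refine Finset.sum_lt_sum ?_ ⟨i, Finset.mem_univ _, ?_⟩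
          · intro k _
            by_cases hki : k = i
            · subst hki; rw [hKi]
              exact Finset.card_le_card (Finset.inter_subset_inter_right (Finset.subset_insert _ _))
            · rw [hKk k hki]
              refine Finset.card_le_card fun x hx => ?_
              have := Finset.disjoint_left.1 (h'.1.2 i k (Ne.symm hki)) hgJ'
              grind
          · rw [hKi, Finset.insert_inter_of_mem hgJ', Finset.card_insert_of_notMem]
            · omega
            · simp [hgJ]
        omega
      · exact ⟨Sum.inl g, (h'.2.2.1 g).2 ⟨i, hgJ'⟩, hgF, K, hKw⟩
    · obtain ⟨e, he', he⟩ := Finset.not_subset.1 hs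
      rcases e with g | ⟨k, j⟩
      · simp [mem_slts_inl] at he'
      · rw [mem_slts_inr] at he' he
        obtain ⟨he', rfl⟩ := he'
        have he : Sum.inr (k, j) ∉ F := by simpa using he
        refine ⟨_, he', he, J, h.1, h.2.1, ?_, ?_⟩
        · intro g; rw [← h.2.2.1 g]; simp
        · intro l
          by_cases hl : l = k
          · subst hl; rw [slts_insert_same _ _ _ he]; omega
          · rw [slts_insert_ne _ _ hl]; exact h.2.2.2 l

theorem wit_mono {γ : Type} [DecidableEq γ] {n m : ℕ} {M : Finset γ} {v : Fin n → Finset γ → ℕ}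
    (hv : ∀ i, MatroidRank M (v i))
    {F F' : Finset (γ ⊕ (Fin n × Fin m))} {J : Fin n → Finset γ}
    (h : Wit M v F' J) (hs : F ⊆ F') : ∃ K, Wit M v F K := by
  have hsub : ∀ i, (J i).filter (fun g => Sum.inl g ∈ F) ⊆ J i := fun i => Finset.filter_subset _ _
  refine ⟨fun i => (J i).filter (fun g => Sum.inl g ∈ F), ⟨?_, ?_⟩, ?_, ?_, ?_⟩
  · exact fun i => (hsub i).trans (h.1.1 i)
  · exact fun i j hij => (h.1.2 i j hij).mono (hsub i) (hsub j)
  · exact fun i => mr_subset (hv i) _ _ (hsub i) (h.1.1 i) (h.2.1 i)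
  · intro g
    have := h.2.2.1 g
    have := @hs (Sum.inl g)
    simp only [Finset.mem_filter]
    grind
  · intro i
    have h1 := Finset.card_le_card (hsub i)
    have h2 : (slts i F).card ≤ (slts i F').card :=
      Finset.card_le_card (Finset.filter_subset_filter _ hs)
    have h3 := h.2.2.2 i
    simp only
    omega

theorem wit_full {γ : Type} [DecidableEq γ] {n m : ℕ} {M : Finset γ} {v : Fin n → Finset γ → ℕ}
    {F : Finset (γ ⊕ (Fin n × Fin m))} {J : Fin n → Finset γ}
    (h : Wit M v F J) (hc : F.card = n * m) (i : Fin n) : (J i).card + (slts i F).card = m := by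
  have h1 := wit_card h
  have h2 : ∑ _i : Fin n, m = n * m := by simp
  rw [hc, ← h2] at h1
  exact ((Finset.sum_eq_sum_iff_of_le (fun i _ => h.2.2.2 i)).1 h1.symm i (Finset.mem_univ _))

theorem wit_le {γ : Type} [DecidableEq γ] {n m : ℕ} {M : Finset γ} {v : Fin n → Finset γ → ℕ}
    {F : Finset (γ ⊕ (Fin n × Fin m))} {J : Fin n → Finset γ}
    (h : Wit M v F J) : F.card ≤ n * m := by
  rw [wit_card h]
  calc _ ≤ ∑ _i : Fin n, m := Finset.sum_le_sum fun i _ => h.2.2.2 i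
    _ = n * m := by simp

/-- The union matroid. -/
def UMat {γ : Type} [DecidableEq γ] {n : ℕ} (m : ℕ) (M : Finset γ) (v : Fin n → Finset γ → ℕ)
    (hv : ∀ i, MatroidRank M (v i)) : IndepMatroid (γ ⊕ (Fin n × Fin m)) :=
  IndepMatroid.ofFinset Set.univ (fun F => ∃ J, Wit M v F J)
    ⟨fun _ => ∅, ⟨by simp, by simp⟩, by intro i; simp [(hv i).2.2.2], by simp, by simp [slts]⟩
    (fun _ _ ⟨_, h⟩ hs => wit_mono hv h hs)
    (fun _ _ ⟨J, h⟩ ⟨_, h'⟩ hlt => wit_aug hv h' hlt _ J h (by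
      exact lt_of_lt_of_le (Nat.lt_succ_self _) (Nat.le_add_left _ _)))
    (fun _ _ => Set.subset_univ _)

theorem umat_indep {γ : Type} [DecidableEq γ] {n : ℕ} (m : ℕ) (M : Finset γ)
    (v : Fin n → Finset γ → ℕ) (hv : ∀ i, MatroidRank M (v i))
    (F : Finset (γ ⊕ (Fin n × Fin m))) :
    (UMat m M v hv).matroid.Indep (F : Set _) ↔ ∃ J, Wit M v F J := by
  rw [IndepMatroid.matroid_indep_iff, UMat, IndepMatroid.ofFinset_indep]

theorem umat_base {γ : Type} [DecidableEq γ] {n : ℕ} (m : ℕ) (M : Finset γ)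
    (v : Fin n → Finset γ → ℕ) (hv : ∀ i, MatroidRank M (v i))
    (F : Finset (γ ⊕ (Fin n × Fin m))) (hF : ∃ J, Wit M v F J) (hc : F.card = n * m) :
    (UMat m M v hv).matroid.IsBase (F : Set _) := by
  rw [Matroid.isBase_iff_maximal_indep]
  refine ⟨(umat_indep m M v hv F).2 hF, ?_⟩
  intro I hI hFI x hx
  by_contra hxF
  have h1 : (UMat m M v hv).matroid.Indep ((insert x F : Finset _) : Set _) := by
    refine hI.subset ?_
    rw [Finset.coe_insert]
    exact Set.insert_subset hx hFI
  obtain ⟨J, hJ⟩ := (umat_indep m M v hv _).1 h1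
  have h2 := wit_le hJ
  rw [Finset.card_insert_of_notMem (by simpa using hxF)] at h2
  omega

/-- The base associated with an allocation. -/
def bas {γ : Type} [DecidableEq γ] {n : ℕ} (m : ℕ) (X : Fin n → Finset γ) :
    Finset (γ ⊕ (Fin n × Fin m)) :=
  (Finset.univ.biUnion X).disjSum (Finset.univ.filter fun p => (X p.1).card ≤ p.2.val)

theorem bas_slts {γ : Type} [DecidableEq γ] {n : ℕ} (m : ℕ) (X : Fin n → Finset γ) (i : Fin n)
    (hm : (X i).card ≤ m) : (X i).card + (slts i (bas m X)).card = m := by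
  have : slts i (bas m X) = (Finset.univ.filter fun j : Fin m => (X i).card ≤ j.val).map
      ⟨fun j => Sum.inr (i, j), fun a b hab => by simpa using hab⟩ := by
    ext z
    rcases z with g | ⟨k, j⟩
    · simp [mem_slts_inl]
    · simp only [mem_slts_inr, bas, Finset.inr_mem_disjSum, Finset.mem_filter, Finset.mem_univ,
        true_and, Finset.mem_map]
      constructor
      · rintro ⟨h1, rfl⟩
        exact ⟨j, h1, rfl⟩
      · rintro ⟨a, h1, h2⟩
        have h2 : (Sum.inr (i, a) : γ ⊕ (Fin n × Fin m)) = Sum.inr (k, j) := h2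
        obtain ⟨rfl, rfl⟩ := Prod.mk.inj (Sum.inr.inj h2)
        exact ⟨h1, rfl⟩
  rw [this, Finset.card_map]
  have h1 : (Finset.univ.filter fun j : Fin m => (X i).card ≤ j.val).card
      = (Finset.Ico (X i).card m).card := by
    rw [← Finset.card_map Fin.valEmbedding]
    congr 1
    ext a
    simp only [Finset.mem_map, Finset.mem_filter, Finset.mem_univ, true_and, Finset.mem_Ico,
      Fin.valEmbedding_apply]
    constructor
    · rintro ⟨j, hj, rfl⟩
      exact ⟨hj, j.2⟩
    · rintro ⟨h1, h2⟩
      exact ⟨⟨a, h2⟩, h1, rfl⟩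
  rw [h1, Nat.card_Ico]
  omega

theorem bas_wit {γ : Type} [DecidableEq γ] {n : ℕ} (M : Finset γ)
    (v : Fin n → Finset γ → ℕ) (X : Fin n → Finset γ) (hX : IsAlloc n M X)
    (hXnr : NonRedundant n v X) : Wit M v (bas M.card X) X :=
  ⟨hX, hXnr, by intro g; simp [bas],
    fun i => (bas_slts _ X i (Finset.card_le_card (hX.1 i))).le⟩

theorem bas_card {γ : Type} [DecidableEq γ] {n : ℕ} (M : Finset γ)
    (v : Fin n → Finset γ → ℕ) (X : Fin n → Finset γ) (hX : IsAlloc n M X)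
    (hXnr : NonRedundant n v X) : (bas M.card X).card = n * M.card := by
  rw [wit_card (bas_wit M v X hX hXnr),
    Finset.sum_congr rfl fun i _ => bas_slts _ X i (Finset.card_le_card (hX.1 i))]
  simp

theorem card_exch {α : Type*} [DecidableEq α] (F : Finset α) {e f : α} (he : e ∈ F) (hf : f ∉ F) :
    (insert f (F.erase e)).card = F.card := by
  rw [Finset.card_insert_of_notMem (by simp [hf]), Finset.card_erase_add_one he]

theorem slts_erase_ne {γ : Type} [DecidableEq γ] {n m : ℕ} {k i : Fin n} (j : Fin m)
    (F : Finset (γ ⊕ (Fin n × Fin m))) (h : k ≠ i) :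
    slts k (F.erase (Sum.inr (i, j))) = slts k F := by
  ext z
  simp only [slts, Finset.mem_filter, Finset.mem_erase]
  constructor
  · tauto
  · rintro ⟨h1, h2⟩
    refine ⟨⟨?_, h1⟩, h2⟩
    rintro rfl
    simp [ownr] at h2
    exact h h2.symm

theorem slts_erase_same {γ : Type} [DecidableEq γ] {n m : ℕ} (i : Fin n) (j : Fin m)
    (F : Finset (γ ⊕ (Fin n × Fin m))) (h : Sum.inr (i, j) ∈ F) :
    (slts i (F.erase (Sum.inr (i, j)))).card + 1 = (slts i F).card := by
  have h1 := slts_insert_same i j (F.erase (Sum.inr (i, j))) (by simp)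
  rw [Finset.insert_erase h] at h1
  exact h1.symm

/-- Exchanging slot `(a, p)` of `X` for slot `(b, q)`. -/
theorem exch_slots {γ : Type} [DecidableEq γ] {n : ℕ} (M : Finset γ)
    (v : Fin n → Finset γ → ℕ) (X : Fin n → Finset γ) (hX : IsAlloc n M X)
    (hXnr : NonRedundant n v X) (a b : Fin n) (hab : a ≠ b) (p q : Fin M.card)
    (hp : Sum.inr (a, p) ∈ bas M.card X) (hq : Sum.inr (b, q) ∉ bas M.card X)
    (hw : ∃ J, Wit M v (insert (Sum.inr (b, q)) ((bas M.card X).erase (Sum.inr (a, p)))) J) :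
    ∃ Y : Fin n → Finset γ, IsAlloc n M Y ∧ NonRedundant n v Y ∧
        (Y a).card = (X a).card + 1 ∧ (Y b).card + 1 = (X b).card ∧
        ∀ k : Fin n, k ≠ a → k ≠ b → (Y k).card = (X k).card := by
  obtain ⟨J, hJ⟩ := hw
  have hc := (card_exch _ hp hq).trans (bas_card M v X hX hXnr)
  have hfull := wit_full hJ hc
  have hb := fun i => bas_slts M.card X i (Finset.card_le_card (hX.1 i))
  have hq' : Sum.inr (b, q) ∉ (bas M.card X).erase (Sum.inr (a, p)) := by simp [hq]
  refine ⟨J, hJ.1, hJ.2.1, ?_, ?_, ?_⟩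
  · have h1 := hfull a
    rw [slts_insert_ne _ _ hab] at h1
    have h2 := slts_erase_same a p _ hp
    have h3 := hb a
    omega
  · have h1 := hfull b
    rw [slts_insert_same _ _ _ hq', slts_erase_ne _ _ hab.symm] at h1
    have h3 := hb b
    omega
  · intro k hka hkb
    have h1 := hfull k
    rw [slts_insert_ne _ _ hkb, slts_erase_ne _ _ hka] at h1
    have h3 := hb k
    omega

/-- Given a non-redundant allocation `X` and a Pareto-optimal non-redundant allocation `A`
with an agent `h ∈ H(X, A)`, there is an agent `ℓ ∈ L(X, A)` such that from `X` one can move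
a unit of utility from `h` to `ℓ`, and from `A` one can move a unit of utility from `ℓ` to `h`,
both via non-redundant allocations. -/
theorem transferLemma {γ : Type} [DecidableEq γ] {n : ℕ} (M : Finset γ)
    (v : Fin n → Finset γ → ℕ) (hv : ∀ i, MatroidRank M (v i))
    (X A : Fin n → Finset γ)
    (hX : IsAlloc n M X) (hXnr : NonRedundant n v X)
    (hA : IsAlloc n M A) (hAnr : NonRedundant n v A) (hApo : ParetoOptimal n M v A)
    (h : Fin n) (hh : (A h).card < (X h).card) :
    ∃ ℓ : Fin n, (X ℓ).card < (A ℓ).card ∧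
      (∃ Y : Fin n → Finset γ, IsAlloc n M Y ∧ NonRedundant n v Y ∧
        (Y ℓ).card = (X ℓ).card + 1 ∧ (Y h).card + 1 = (X h).card ∧
        ∀ k : Fin n, k ≠ ℓ → k ≠ h → (Y k).card = (X k).card) ∧
      (∃ B : Fin n → Finset γ, IsAlloc n M B ∧ NonRedundant n v B ∧
        (B ℓ).card + 1 = (A ℓ).card ∧ (B h).card = (A h).card + 1 ∧
        ∀ k : Fin n, k ≠ ℓ → k ≠ h → (B k).card = (A k).card) := by
  have hXw := bas_wit M v X hX hXnr
  have hAw := bas_wit M v A hA hAnr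
  have hXb := umat_base M.card M v hv _ ⟨X, hXw⟩ (bas_card M v X hX hXnr)
  have hAb := umat_base M.card M v hv _ ⟨A, hAw⟩ (bas_card M v A hA hAnr)
  have hXm := Finset.card_le_card (hX.1 h)
  set p : Fin M.card := ⟨(A h).card, by omega⟩ with hp
  have heA : Sum.inr (h, p) ∈ bas M.card A := by simp [bas, hp]
  have heX : Sum.inr (h, p) ∉ bas M.card X := by simp [bas, hp, hh]
  obtain ⟨f, hfX, hfA, hi1, hi2⟩ := symmExch _ hXb hAb (Finset.mem_coe.2 heA) (by simpa using heX)
  rw [Finset.mem_coe] at hfX hfA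
  have hne : Sum.inr (h, p) ≠ f := by rintro rfl; exact hfA heA
  rw [← Finset.coe_erase, ← Finset.coe_insert, umat_indep] at hi1
  rw [← Finset.coe_insert, ← Finset.coe_erase, umat_indep, Finset.erase_insert_of_ne hne] at hi2
  rcases f with g | ⟨ℓ, q⟩
  · exfalso
    obtain ⟨J, hJ⟩ := hi1
    have hc := (card_exch _ heA hfA).trans (bas_card M v A hA hAnr)
    have hfull := wit_full hJ hc
    have hb := fun i => bas_slts M.card A i (Finset.card_le_card (hA.1 i))
    have hJh : (J h).card = (A h).card + 1 := by
      have h1 := hfull h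
      rw [slts_insert_inl] at h1
      have h2 := slts_erase_same h p _ heA
      have h3 := hb h
      omega
    refine hApo ⟨J, hJ.1, ?_, h, ?_⟩
    · intro k
      rw [hAnr k, hJ.2.1 k]
      by_cases hk : k = h
      · subst hk; omega
      · have h1 := hfull k
        rw [slts_insert_inl, slts_erase_ne _ _ hk] at h1
        have h3 := hb k
        omega
    · rw [hAnr h, hJ.2.1 h]; omega
  · have hlt : (X ℓ).card < (A ℓ).card := by
      simp [bas] at hfX hfA
      omega
    have hlh : ℓ ≠ h := by rintro rfl; omega
    refine ⟨ℓ, hlt, ?_, ?_⟩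
    · exact exch_slots M v X hX hXnr ℓ h hlh q p hfX heX hi2
    · obtain ⟨B, h1, h2, h3, h4, h5⟩ := exch_slots M v A hA hAnr h ℓ hlh.symm p q heA hfA hi1
      exact ⟨B, h1, h2, h4, h3, fun k hk hk' => h5 k hk' hk⟩
end

section
/- Let I and I' be instances with the same agents N, the same positive weights, and matroid-rank valuations such that I' is obtained from I by adding one extra good g (each agent's valuation in I is the restriction to G of her valuation in I' on G ∪ {g}). Let f be strictly increasing, let A be an R^tie_f allocation of I, and let A' be an R^tie_f allocation of I'. If L(A', A) ≠ ∅, then H(A', A) ≠ ∅. -/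
open Finset

theorem ereal_sum_ne_top {ι : Type} [DecidableEq ι] (s : Finset ι) (G : ι → EReal)
    (h : ∀ i ∈ s, G i ≠ ⊤) : ∑ i ∈ s, G i ≠ ⊤ := by
  induction s using Finset.induction_on with
  | empty => simp
  | insert a s ha ih =>
    rw [Finset.sum_insert ha]
    exact EReal.add_ne_top (h a (by simp)) (ih fun i hi => h i (by simp [hi]))

theorem ereal_sum_lt {ι : Type} [DecidableEq ι] (s : Finset ι) (F G : ι → EReal)
    (hle : ∀ i ∈ s, F i ≤ G i) (i : ι) (hi : i ∈ s) (hlt : F i < G i)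
    (hF : ∑ i ∈ s, F i ≠ ⊥) (hG : ∀ i ∈ s, G i ≠ ⊤) :
    ∑ i ∈ s, F i < ∑ i ∈ s, G i := by
  rw [← Finset.add_sum_erase s F hi] at hF ⊢
  rw [← Finset.add_sum_erase s G hi]
  refine EReal.add_lt_add_of_lt_of_le hlt
    (Finset.sum_le_sum fun j hj => hle j (Finset.mem_of_mem_erase hj)) ?_ ?_
  · intro h
    exact hF (EReal.add_eq_bot_iff.2 (Or.inr h))
  · exact ereal_sum_ne_top _ _ fun j hj => hG j (Finset.mem_of_mem_erase hj)

theorem ereal_coe_mul_ne_top {w : ℝ} (hw : 0 < w) {a : EReal} (ha : a ≠ ⊤) :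
    (w : EReal) * a ≠ ⊤ := by
  induction a with
  | bot => rw [EReal.coe_mul_bot_of_pos hw]; simp
  | top => exact absurd rfl ha
  | coe x => rw [← EReal.coe_mul]; exact EReal.coe_ne_top _

theorem ereal_coe_mul_ne_bot {w : ℝ} (hw : 0 < w) {a : EReal} (ha : a ≠ ⊥) :
    (w : EReal) * a ≠ ⊥ := by
  induction a with
  | bot => exact absurd rfl ha
  | top => rw [EReal.coe_mul_top_of_pos hw]; simp
  | coe x => rw [← EReal.coe_mul]; exact EReal.coe_ne_bot _

theorem ereal_coe_mul_lt {w : ℝ} (hw : 0 < w) {a b : EReal} (hab : a < b) (hb : b ≠ ⊤) :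
    (w : EReal) * a < w * b := by
  induction b with
  | bot => exact absurd hab not_lt_bot
  | top => exact absurd rfl hb
  | coe y =>
    induction a with
    | bot => rw [EReal.coe_mul_bot_of_pos hw, ← EReal.coe_mul]; exact EReal.bot_lt_coe _
    | top => exact absurd hab not_top_lt
    | coe x =>
      rw [← EReal.coe_mul, ← EReal.coe_mul]
      exact EReal.coe_lt_coe_iff.2 (mul_lt_mul_of_pos_left (EReal.coe_lt_coe_iff.1 hab) hw)

theorem ereal_sum_ne_bot {ι : Type} [DecidableEq ι] (s : Finset ι) (G : ι → EReal)
    (h : ∀ i ∈ s, G i ≠ ⊥) : ∑ i ∈ s, G i ≠ ⊥ := by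
  induction s using Finset.induction_on with
  | empty => simp
  | insert a s ha ih =>
    rw [Finset.sum_insert ha, Ne, EReal.add_eq_bot_iff, not_or]
    exact ⟨h a (by simp), ih fun i hi => h i (by simp [hi])⟩

/-- When a good is added to an instance, if some agent's `R^tie_f` bundle shrinks,
then some agent's `R^tie_f` bundle grows. -/
theorem addGoodLowerHigher {γ : Type} [DecidableEq γ] {n : ℕ} (M : Finset γ)
    (g : γ) (hg : g ∉ M)
    (w : Fin n → ℝ) (hw : ∀ i, 0 < w i)
    (v : Fin n → Finset γ → ℕ) (hv : ∀ i, MatroidRank (insert g M) (v i))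
    (f : ℕ → EReal) (hf : StrictMono f) (hftop : ∀ k, f k ≠ ⊤)
    (A A' : Fin n → Finset γ)
    (hA : IsRfTie n M w v f A) (hA' : IsRfTie n (insert g M) w v f A')
    (hL : ∃ i : Fin n, (A' i).card < (A i).card) :
    ∃ j : Fin n, (A j).card < (A' j).card := by
  by_contra hcon
  push Not at hcon
  obtain ⟨i, hi⟩ := hL
  obtain ⟨⟨⟨hAM, hAd⟩, -, -⟩, -, hAn⟩ := hA
  obtain ⟨⟨hA'al, hA'1, hA'2⟩, -, hA'n⟩ := hA'
  have hAal : IsAlloc n (insert g M) A :=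
    ⟨fun j => (hAM j).trans (Finset.subset_insert g M), hAd⟩
  have hle : ∀ j, v j (A' j) ≤ v j (A j) := fun j => by
    rw [hAn j, hA'n j]; exact hcon j
  have hlt : v i (A' i) < v i (A i) := by
    rw [hAn i, hA'n i]; exact hi
  have hterm : ∀ j, (w j : EReal) * f (v j (A' j)) ≤ w j * f (v j (A j)) := fun j => by
    rcases (hle j).eq_or_lt with h | h
    · rw [h]
    · exact (ereal_coe_mul_lt (hw j) (hf h) (hftop _)).le
  have htermlt := ereal_coe_mul_lt (hw i) (hf hlt) (hftop _)
  by_cases hB : ∃ B, IsAlloc n (insert g M) B ∧ Welfare n w v f B ≠ ⊥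
  · have hmax := hA'1 hB
    obtain ⟨B, hBal, hBne⟩ := hB
    have hne : Welfare n w v f A' ≠ ⊥ := fun h =>
      hBne (le_bot_iff.1 (h ▸ hmax B hBal))
    exact absurd (hmax A hAal) (not_le.2 (ereal_sum_lt _ _ _ (fun j _ => hterm j) i
      (Finset.mem_univ i) htermlt hne
      fun j _ => ereal_coe_mul_ne_top (hw j) (hftop _)))
  · push Not at hB
    obtain ⟨h1, h2⟩ := hA'2 hB A hAal
    have hsub : PosAgents n v A' ⊆ PosAgents n v A := fun j hj => by
      simp only [PosAgents, Finset.mem_filter, Finset.mem_univ, true_and] at hj ⊢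
      exact hj.trans_le (hle j)
    have hcard : (PosAgents n v A).card ≤ (PosAgents n v A').card := by
      rcases h1 with h | h
      · exact h.le
      · exact h.1.le
    have heq : PosAgents n v A' = PosAgents n v A := Finset.eq_of_subset_of_card_le hsub hcard
    have hR := h2 heq.symm
    unfold RWelfare at hR
    rw [heq] at hR
    refine absurd hR (not_le.2 (ereal_sum_lt _ _ _ (fun j _ => hterm j) i ?_ htermlt ?_
      fun j _ => ereal_coe_mul_ne_top (hw j) (hftop _)))
    · simp only [PosAgents, Finset.mem_filter, Finset.mem_univ, true_and]
      omega
    · rw [← heq]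
      refine ereal_sum_ne_bot _ _ fun j hj => ereal_coe_mul_ne_bot (hw j) ?_
      simp only [PosAgents, Finset.mem_filter, Finset.mem_univ, true_and] at hj
      exact (bot_le.trans_lt (hf hj)).ne'
end

section
/- Let I and I' be instances with agents N, positive weights, and matroid-rank valuations such that I' is obtained from I by adding one extra good g, let f be strictly increasing, and let A be an R^tie_f allocation of I. Let I* be obtained from I' by adding an extra agent 0 with an arbitrary positive weight and binary additive valuation v_0 with v_0({g}) = 1 and v_0({ḡ}) = 0 for all ḡ ≠ g. Let Â be the allocation in I* that agrees with A on N and has the additional bundle Â_0 = {g}. If g ∉ F_i(Â_i) for all i ∈ N and there is no directed path with at least one edge in the exchange graph G(Â) starting at a good in F_j(Â_j) for some j ∈ N and ending at g, then A is an R^tie_f allocation of I'. -/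
open Finset

/-- `M₁` is dominated by `M₂`: each allocation of `M₁` is weakly improved by one of `M₂`. -/
def Dom {γ : Type} (n : ℕ) (v : Fin n → Finset γ → ℕ) (M₁ M₂ : Finset γ) : Prop :=
  ∀ B, IsAlloc n M₁ B → ∃ C, IsAlloc n M₂ C ∧ ∀ i, v i (B i) ≤ v i (C i)

lemma term_mono {w : ℝ} (hw : 0 < w) {f : ℕ → EReal} (hf : StrictMono f) {a b : ℕ}
    (h : a ≤ b) : (w : EReal) * f a ≤ (w : EReal) * f b :=
  mul_le_mul_of_nonneg_left (hf.monotone h) (by exact_mod_cast hw.le)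

lemma welfare_mono {γ : Type} {n : ℕ} {w : Fin n → ℝ} (hw : ∀ i, 0 < w i)
    {v : Fin n → Finset γ → ℕ} {f : ℕ → EReal} (hf : StrictMono f)
    {B C : Fin n → Finset γ} (h : ∀ i, v i (B i) ≤ v i (C i)) :
    Welfare n w v f B ≤ Welfare n w v f C :=
  Finset.sum_le_sum fun i _ => term_mono (hw i) hf (h i)

lemma rwelfare_mono {γ : Type} {n : ℕ} {w : Fin n → ℝ} (hw : ∀ i, 0 < w i)
    {v : Fin n → Finset γ → ℕ} {f : ℕ → EReal} (hf : StrictMono f)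
    {B C : Fin n → Finset γ} (h : ∀ i, v i (B i) ≤ v i (C i))
    (hP : PosAgents n v B = PosAgents n v C) :
    RWelfare n w v f B ≤ RWelfare n w v f C := by
  unfold RWelfare
  rw [hP]
  exact Finset.sum_le_sum fun i _ => term_mono (hw i) hf (h i)

lemma posAgents_mono {γ : Type} {n : ℕ}
    {v : Fin n → Finset γ → ℕ}
    {B C : Fin n → Finset γ} (h : ∀ i, v i (B i) ≤ v i (C i)) :
    PosAgents n v B ⊆ PosAgents n v C := by
  intro i hi
  simp only [PosAgents, Finset.mem_filter, Finset.mem_univ, true_and] at hi ⊢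
  exact lt_of_lt_of_le hi (h i)

lemma isRf_transfer {γ : Type} {n : ℕ} {M₁ M₂ : Finset γ} {w : Fin n → ℝ} (hw : ∀ i, 0 < w i)
    {v : Fin n → Finset γ → ℕ} {f : ℕ → EReal} (hf : StrictMono f)
    (h12 : Dom n v M₁ M₂) (h21 : Dom n v M₂ M₁)
    {A A' : Fin n → Finset γ} (hA : IsRf n M₁ w v f A) (hA' : IsAlloc n M₂ A')
    (hAA : ∀ i, v i (A i) ≤ v i (A' i)) : IsRf n M₂ w v f A' := by
  obtain ⟨hal, h1, h2⟩ := hA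
  refine ⟨hA', ?_, ?_⟩
  · rintro ⟨B, hB, hBne⟩ C hC
    obtain ⟨B', hB', hBB⟩ := h21 B hB
    obtain ⟨C', hC', hCC⟩ := h21 C hC
    have hne : Welfare n w v f B' ≠ ⊥ := by
      intro h
      have := welfare_mono hw hf hBB
      rw [h, le_bot_iff] at this
      exact hBne this
    exact (welfare_mono hw hf hCC).trans ((h1 ⟨B', hB', hne⟩ C' hC').trans
      (welfare_mono hw hf hAA))
  · intro hbot
    have hbot1 : ∀ B, IsAlloc n M₁ B → Welfare n w v f B = ⊥ := by
      intro B hB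
      obtain ⟨B', hB', hBB⟩ := h12 B hB
      have := welfare_mono hw hf hBB (w := w)
      rw [hbot B' hB', le_bot_iff] at this
      exact this
    have h3 := h2 hbot1
    have hPA : PosAgents n v A = PosAgents n v A' := by
      apply Finset.eq_of_subset_of_card_le (posAgents_mono hAA)
      obtain ⟨D, hD, hDD⟩ := h21 A' hA'
      have hc := Finset.card_le_card (posAgents_mono hDD)
      have := (h3 D hD).1
      omega
    intro B hB
    obtain ⟨B', hB', hBB⟩ := h21 B hB
    have hsub := posAgents_mono hBB
    have hc := Finset.card_le_card hsub
    obtain ⟨h4, h5⟩ := h3 B' hB'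
    rw [← hPA]
    constructor
    · rcases h4 with h4 | ⟨h4, h6⟩
      · left; omega
      · rcases Nat.lt_or_ge (PosAgents n v B).card (PosAgents n v B').card with h | h
        · left; omega
        · have := Finset.eq_of_subset_of_card_le hsub h
          right
          rw [this]
          exact ⟨h4, h6⟩
    · intro he
      have hle : (PosAgents n v B').card ≤ (PosAgents n v A).card := by omega
      have hBB' : PosAgents n v B = PosAgents n v B' :=
        Finset.eq_of_subset_of_card_le hsub (by rw [he]; exact hle)
      exact (rwelfare_mono hw hf hBB hBB').trans ((h5 (hBB'.symm.trans he)).trans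
        (rwelfare_mono hw hf hAA hPA))

/-- If no element of `A \ X` lies on the fundamental circuit of `x`, then `x` is spanned by
`A ∩ X`. -/
lemma span_inter {γ : Type} [DecidableEq γ] {M : Finset γ} {v : Finset γ → ℕ}
    (hv : MatroidRank M v) {A : Finset γ} (hAM : A ⊆ M) (hA : v A = A.card)
    {x : γ} (hx : x ∈ M) (hxA : x ∉ A) (hF : v (insert x A) ≤ v A) (D : Finset γ) (hD : D ⊆ A)
    (hE : ∀ a ∈ D, v ((insert x A).erase a) ≠ v A) :
    v (insert x (A \ D)) + D.card ≤ A.card := by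
  obtain ⟨-, hmono, hsub, -⟩ := hv
  have hxAM : insert x A ⊆ M := Finset.insert_subset hx hAM
  induction D using Finset.induction_on with
  | empty => simpa [hA] using hF
  | insert a D ha ih =>
    have ih' := ih (fun y hy => hD (by simp [hy])) (fun y hy => hE y (by simp [hy]))
    have haA : a ∈ A := hD (by simp)
    have hax : a ≠ x := fun h => hxA (h ▸ haA)
    have hlt : v ((insert x A).erase a) < v A := by
      refine lt_of_le_of_ne ?_ (hE a (by simp))
      exact (hmono _ _ (Finset.erase_subset _ _) hxAM).trans hF
    have hs := hsub (insert x (A \ insert a D)) ((insert x A).erase a)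
      (by
        intro y hy
        simp only [Finset.mem_insert, Finset.mem_sdiff, Finset.mem_erase] at hy ⊢
        grind)
      ((Finset.erase_subset _ _).trans hxAM) a (hAM haA) (by simp)
    rw [Finset.insert_erase (by simp [haA])] at hs
    have e : insert a (insert x (A \ insert a D)) = insert x (A \ D) := by
      ext y
      simp only [Finset.mem_insert, Finset.mem_sdiff]
      grind
    rw [e] at hs
    have hm := hmono A (insert x A) (Finset.subset_insert _ _) hxAM
    rw [Finset.card_insert_of_notMem ha]
    omega

/-- If `I` spans each element of `Y`, then `T ∪ I` spans `T ∪ I ∪ Y`. -/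
lemma span_union {γ : Type} [DecidableEq γ] {M : Finset γ} {v : Finset γ → ℕ}
    (hv : MatroidRank M v) {I T : Finset γ} (hI : I ⊆ M) (hT : T ⊆ M) (Y : Finset γ)
    (hY : Y ⊆ M) (hs : ∀ x ∈ Y, v (insert x I) ≤ v I) :
    v (T ∪ I ∪ Y) ≤ v (T ∪ I) := by
  obtain ⟨-, hmono, hsub, -⟩ := hv
  induction Y using Finset.induction_on with
  | empty => simp
  | insert x Y hx ih =>
    have ih' := ih (fun y hy => hY (by simp [hy])) (fun y hy => hs y (by simp [hy]))
    rw [Finset.union_insert]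
    by_cases hm : x ∈ T ∪ I ∪ Y
    · rwa [Finset.insert_eq_of_mem hm]
    · have := hsub I (T ∪ I ∪ Y) (by intro y hy; simp [hy])
        (Finset.union_subset (Finset.union_subset hT hI) (fun y hy => hY (by simp [hy])))
        x (hY (by simp)) hm
      have := hs x (by simp)
      omega

/-- Subsets of an independent set are independent. -/
lemma span_indep {γ : Type} [DecidableEq γ] {M : Finset γ} {v : Finset γ → ℕ}
    (hv : MatroidRank M v) {A : Finset γ} (hAM : A ⊆ M) (hA : v A = A.card)
    (D : Finset γ) (hD : D ⊆ A) : A.card ≤ v (A \ D) + D.card := by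
  obtain ⟨hbin, -, -, -⟩ := hv
  induction D using Finset.induction_on with
  | empty => simp [hA]
  | insert a D ha ih =>
    have ih' := ih (fun y hy => hD (by simp [hy]))
    have haA : a ∈ A := hD (by simp)
    have h := hbin (A \ insert a D) (Finset.sdiff_subset.trans hAM) a (hAM haA) (by simp)
    have e : insert a (A \ insert a D) = A \ D := by
      ext y
      simp only [Finset.mem_insert, Finset.mem_sdiff]
      grind
    rw [e] at h
    rw [Finset.card_insert_of_notMem ha]
    omega

/-- If, after adding the dummy agent `0` owning the new good `g`, `g` gives no agent positive
marginal value and no nondegenerate exchange-graph path reaches `g` from some `F_j(Â_j)`,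
then the old `R^tie_f` allocation `A` is still an `R^tie_f` allocation of the new instance. -/
theorem noPathKeepsAllocation {γ : Type} [DecidableEq γ] {n : ℕ} (M : Finset γ)
    (g : γ) (hg : g ∉ M)
    (w : Fin n → ℝ) (hw : ∀ i, 0 < w i)
    (v : Fin n → Finset γ → ℕ) (hv : ∀ i, MatroidRank (insert g M) (v i))
    (f : ℕ → EReal) (hf : StrictMono f) (hftop : ∀ k, f k ≠ ⊤)
    (A : Fin n → Finset γ) (hA : IsRfTie n M w v f A)
    (w0 : ℝ) (hw0 : 0 < w0)
    (vstar : Fin (n + 1) → Finset γ → ℕ)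
    (hvstar0 : vstar 0 = fun S => if g ∈ S then 1 else 0)
    (hvstarS : ∀ i : Fin n, vstar i.succ = v i)
    (Ahat : Fin (n + 1) → Finset γ)
    (hAhat0 : Ahat 0 = {g}) (hAhatS : ∀ i : Fin n, Ahat i.succ = A i)
    (hnoF : ∀ i : Fin n, ¬ FSet (insert g M) (v i) (A i) g)
    (hnopath : ¬ ∃ (j : Fin n) (P : List γ),
      P.Chain' (ExEdge (n + 1) (insert g M) vstar Ahat) ∧ 2 ≤ P.length ∧
      (∃ a, P.head? = some a ∧ FSet (insert g M) (v j) (A j) a) ∧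
      P.getLast? = some g) :
    IsRfTie n (insert g M) w v f A := by
  classical
  obtain ⟨hRf, hlex, hnr⟩ := hA
  have hMM : M ⊆ insert g M := Finset.subset_insert _ _
  have hup : ∀ B, IsAlloc n M B → IsAlloc n (insert g M) B :=
    fun B hB => ⟨fun i => (hB.1 i).trans hMM, hB.2⟩
  have hAal := hRf.1
  -- the goods from which `g` can be reached
  set E := ExEdge (n + 1) (insert g M) vstar Ahat with hE
  set X := (insert g M).filter fun x => Relation.ReflTransGen E x g with hX
  have hXM : X ⊆ insert g M := Finset.filter_subset _ _
  have hXF : ∀ x ∈ X, ∀ j, ¬ FSet (insert g M) (v j) (A j) x := by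
    intro x hx j hFx
    have hr := (Finset.mem_filter.1 hx).2
    obtain ⟨l, hl, hlast⟩ := List.exists_isChain_cons_of_relationReflTransGen hr
    cases l with
    | nil =>
      simp at hlast
      subst hlast
      exact hnoF j hFx
    | cons b l =>
      refine hnopath ⟨j, x :: b :: l, hl, by simp, ⟨x, by simp, hFx⟩, ?_⟩
      rw [List.getLast?_eq_getLast_of_ne_nil (by simp), hlast]
  have hspan : ∀ i, ∀ x ∈ X, v i (insert x (A i ∩ X)) ≤ v i (A i ∩ X) := by
    intro i x hx
    by_cases hxA : x ∈ A i
    · rw [Finset.insert_eq_of_mem (Finset.mem_inter.2 ⟨hxA, hx⟩)]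
    have hAM := (hAal.1 i).trans hMM
    have hee : A i \ (A i \ X) = A i ∩ X := by
      ext y
      simp only [Finset.mem_sdiff, Finset.mem_inter]
      tauto
    have hxM := hXM hx
    have hF : v i (insert x (A i)) ≤ v i (A i) := by
      rcases (hv i).1 (A i) hAM x hxM hxA with h | h
      · exact h.le
      · exact absurd ⟨hxM, hxA, h⟩ (hXF x hx i)
    have hs := span_inter (hv i) hAM (hnr i) hxM hxA hF (A i \ X) Finset.sdiff_subset (by
      intro a ha he
      obtain ⟨ha1, ha2⟩ := Finset.mem_sdiff.1 ha
      apply ha2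
      refine Finset.mem_filter.2 ⟨hAM ha1, Relation.ReflTransGen.head ?_
        (Finset.mem_filter.1 hx).2⟩
      refine ⟨hAM ha1, hxM, i.succ, ?_⟩
      rw [hAhatS, hvstarS]
      exact ⟨ha1, hxA, he⟩)
    rw [hee] at hs
    have hc := Finset.card_sdiff_add_card_inter (A i) X
    have hi : (A i ∩ X).card ≤ v i (A i ∩ X) := by
      have := span_indep (hv i) hAM (hnr i) (A i \ X) Finset.sdiff_subset
      rw [hee] at this
      omega
    omega
  have hdown : Dom n v (insert g M) M := by
    intro B hB
    refine ⟨fun i => (B i \ X) ∪ (A i ∩ X), ⟨?_, ?_⟩, ?_⟩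
    · intro i y hy
      rcases Finset.mem_union.1 hy with h | h
      · obtain ⟨h1, h2⟩ := Finset.mem_sdiff.1 h
        rcases Finset.mem_insert.1 (hB.1 i h1) with h3 | h3
        · exact absurd (Finset.mem_filter.2 ⟨by simp [h3], by rw [h3]⟩) h2
        · exact h3
      · exact hAal.1 i (Finset.mem_inter.1 h).1
    · intro i j hij
      have h1 := Finset.disjoint_left.1 (hB.2 i j hij)
      have h2 := Finset.disjoint_left.1 (hAal.2 i j hij)
      rw [Finset.disjoint_left]
      intro y hy hy'
      simp only [Finset.mem_union, Finset.mem_sdiff, Finset.mem_inter] at hy hy'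
      have := @h1 y
      have := @h2 y
      tauto
    · intro i
      have hAX : A i ∩ X ⊆ insert g M := Finset.inter_subset_right.trans hXM
      have hBX : B i \ X ⊆ insert g M := Finset.sdiff_subset.trans (hB.1 i)
      refine le_trans ?_ (span_union (hv i) hAX hBX X hXM (hspan i))
      apply (hv i).2.1
      · intro y hy
        simp only [Finset.mem_union, Finset.mem_sdiff, Finset.mem_inter]
        tauto
      · exact Finset.union_subset (Finset.union_subset hBX hAX) hXM
  have hupD : Dom n v M (insert g M) := fun B hB => ⟨B, hup B hB, fun _ => le_rfl⟩
  refine ⟨isRf_transfer hw hf hupD hdown hRf (hup A hAal) (fun _ => le_rfl), ?_, hnr⟩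
  rintro B hB ⟨i, hi, hlt⟩
  obtain ⟨C, hC, hBC⟩ := hdown B hB.1
  refine hlex C (isRf_transfer hw hf hdown hupD hB hC hBC) ?_
  have hex : ∃ k : Fin n, v k (A k) < v k (C k) := ⟨i, lt_of_lt_of_le hi (hBC i)⟩
  obtain ⟨k, hk, hmin⟩ := WellFounded.has_min (wellFounded_lt (α := Fin n))
    {k | v k (A k) < v k (C k)} hex
  refine ⟨k, hk, fun j hj => ?_⟩
  have hki : k ≤ i := not_lt.1 (hmin i (lt_of_lt_of_le hi (hBC i)))
  have h1 := hlt j (lt_of_lt_of_le hj hki)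
  have h2 := hBC j
  have h3 : ¬ v j (A j) < v j (C j) := fun h => hmin j h hj
  simp only at h1 ⊢
  omega
end

section
/- Consider an instance whose agents are N ∪ {0}, all with matroid-rank valuations, where agent 0 has an arbitrary positive weight and a binary additive valuation v_0 with v_0({g}) = 1 for some good g and v_0({ḡ}) = 0 for all ḡ ≠ g. Let X = (X_0, X_1,…,X_n) be a non-redundant allocation with |X_0| = 0, and let A = (A_0, A_1,…,A_n) be a Pareto-optimal non-redundant allocation. If there exists an agent h ∈ N with |X_h| > |A_h| + 1, or if there exist two distinct agents h, h' ∈ N both belonging to H(X, A), then there exists an agent in L(X, A) different from agent 0. -/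
open Finset

theorem MatroidRank.le_card {γ : Type} [DecidableEq γ] {M : Finset γ} {v : Finset γ → ℕ}
    (hv : MatroidRank M v) (S : Finset γ) (hS : S ⊆ M) : v S ≤ S.card := by
  induction S using Finset.induction_on with
  | empty => simp [hv.2.2.2]
  | insert a S ha ih =>
    have hS' : S ⊆ M := fun x hx => hS (mem_insert_of_mem hx)
    have h1 := hv.1 S hS' a (hS (mem_insert_self _ _)) ha
    have h2 := ih hS'
    rw [card_insert_of_notMem ha]
    omega

theorem MatroidRank.erase_indep {γ : Type} [DecidableEq γ] {M : Finset γ} {v : Finset γ → ℕ}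
    (hv : MatroidRank M v) (S : Finset γ) (hS : S ⊆ M) (h : v S = S.card) (a : γ) :
    v (S.erase a) = (S.erase a).card := by
  by_cases ha : a ∈ S
  · have hS' : S.erase a ⊆ M := (erase_subset _ _).trans hS
    have h1 := hv.1 _ hS' a (hS ha) (notMem_erase a S)
    have h2 := hv.le_card _ hS'
    rw [insert_erase ha] at h1
    have h3 := card_erase_add_one ha
    omega
  · rw [erase_eq_of_notMem ha, h]

theorem MatroidRank.exchange {γ : Type} [DecidableEq γ] {M : Finset γ} {v : Finset γ → ℕ}
    (hv : MatroidRank M v) (Y A : Finset γ) (hY : Y ⊆ M) (hA : A ⊆ M) (hYi : v Y = Y.card)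
    (hAi : v A = A.card) (hlt : Y.card < A.card) :
    ∃ a ∈ A, a ∉ Y ∧ v (insert a Y) = (insert a Y).card := by
  by_contra hcon
  have hc : ∀ a ∈ A, a ∉ Y → v (insert a Y) = v Y := by
    intro a ha haY
    by_contra hne
    refine hcon ⟨a, ha, haY, ?_⟩
    have h1 := hv.1 Y hY a (hA ha) haY
    rw [card_insert_of_notMem haY]
    omega
  have key : ∀ T : Finset γ, T ⊆ A → v (Y ∪ T) ≤ v Y := by
    intro T
    induction T using Finset.induction_on with
    | empty => simp
    | insert c T hcT ih =>
      intro hT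
      have hT' : T ⊆ A := fun x hx => hT (mem_insert_of_mem hx)
      have hcA : c ∈ A := hT (mem_insert_self _ _)
      have h1 := ih hT'
      rw [union_insert]
      by_cases hcY : c ∈ Y ∪ T
      · rw [insert_eq_of_mem hcY]; exact h1
      · have h2 := hv.2.2.1 Y (Y ∪ T) subset_union_left
          (union_subset hY (hT'.trans hA)) c (hA hcA) hcY
        have h3 := hc c hcA (fun h => hcY (mem_union_left _ h))
        omega
  have h1 := key A (Subset.refl _)
  have h2 := hv.2.1 A (Y ∪ A) subset_union_right (union_subset hY hA)
  omega

/-- A non-redundant allocation of larger total size than `A` in which at most one agent `k`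
falls short of her bundle size in `A`, and by at most one, contradicts Pareto-optimality. -/
theorem augment_aux {γ : Type} [DecidableEq γ] {n : ℕ} (M : Finset γ)
    (v : Fin n → Finset γ → ℕ) (hv : ∀ i, MatroidRank M (v i))
    (A : Fin n → Finset γ) (hA : IsAlloc n M A) (hAnr : NonRedundant n v A)
    (hApo : ParetoOptimal n M v A) (d : ℕ) :
    ∀ (Y : Fin n → Finset γ) (k : Fin n), IsAlloc n M Y → NonRedundant n v Y →
      (∀ i, i ≠ k → (A i).card ≤ (Y i).card) → (A k).card ≤ (Y k).card + 1 →
      ∑ i, (A i).card < ∑ i, (Y i).card →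
      ∑ i, (A i).card ≤ ∑ i, (Y i ∩ A i).card + d → False := by
  induction d with
  | zero =>
    intro Y k hY hYnr hge _ hsum hd
    have hle : ∀ i ∈ (univ : Finset (Fin n)), (Y i ∩ A i).card ≤ (A i).card :=
      fun i _ => card_le_card inter_subset_right
    have heq := (sum_eq_sum_iff_of_le hle).1 (le_antisymm (sum_le_sum hle) (by simpa using hd))
    have hge' : ∀ i, (A i).card ≤ (Y i).card := fun i => by
      rw [← heq i (mem_univ i)]; exact card_le_card inter_subset_left
    obtain ⟨i, -, hi⟩ := exists_lt_of_sum_lt hsum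
    refine hApo ⟨Y, hY, fun i => ?_, i, ?_⟩
    · rw [hAnr, hYnr]; exact hge' i
    · rw [hAnr, hYnr]; exact hi
  | succ d ih =>
    intro Y k hY hYnr hge hk hsum hd
    by_cases hkk : (A k).card ≤ (Y k).card
    · obtain ⟨i, -, hi⟩ := exists_lt_of_sum_lt hsum
      refine hApo ⟨Y, hY, fun i => ?_, i, ?_⟩
      · rw [hAnr, hYnr]
        by_cases hik : i = k
        · rw [hik]; exact hkk
        · exact hge i hik
      · rw [hAnr, hYnr]; exact hi
    · obtain ⟨a, haA, haY, hai⟩ := (hv k).exchange (Y k) (A k) (hY.1 k) (hA.1 k) (hYnr k)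
        (hAnr k) (by omega)
      let Z : Fin n → Finset γ := fun i => if i = k then insert a (Y k) else (Y i).erase a
      have hZk : Z k = insert a (Y k) := if_pos rfl
      have hZi : ∀ i, i ≠ k → Z i = (Y i).erase a := fun i hi => if_neg hi
      have hZcard : (Z k).card = (Y k).card + 1 := by
        rw [hZk, card_insert_of_notMem haY]
      have hZalloc : IsAlloc n M Z := by
        refine ⟨fun i => ?_, fun i j hij => ?_⟩
        · by_cases hik : i = k
          · subst hik; rw [hZk]; exact insert_subset (hA.1 i haA) (hY.1 i)
          · rw [hZi i hik]; exact (erase_subset _ _).trans (hY.1 i)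
        · have hd := hY.2 i j hij
          rw [Finset.disjoint_left] at hd ⊢
          intro x hx hx'
          by_cases hik : i = k
          · subst hik
            rw [hZk, mem_insert] at hx
            rw [hZi j (Ne.symm hij), mem_erase] at hx'
            exact hd (hx.resolve_left hx'.1) hx'.2
          · rw [hZi i hik, mem_erase] at hx
            by_cases hjk : j = k
            · subst hjk
              rw [hZk, mem_insert] at hx'
              exact hd hx.2 (hx'.resolve_left hx.1)
            · rw [hZi j hjk, mem_erase] at hx'
              exact hd hx.2 hx'.2
      have hZnr : NonRedundant n v Z := by
        intro i
        by_cases hik : i = k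
        · subst hik; rw [hZk]; exact hai
        · rw [hZi i hik]; exact (hv i).erase_indep _ (hY.1 i) (hYnr i) a
      have hZsum : ∑ i, (Y i).card ≤ ∑ i, (Z i).card := by
        rw [← card_biUnion (fun i _ j _ hij => hY.2 i j hij),
          ← card_biUnion (fun i _ j _ hij => hZalloc.2 i j hij)]
        apply card_le_card
        intro x hx
        simp only [mem_biUnion, mem_univ, true_and] at hx ⊢
        obtain ⟨i, hi⟩ := hx
        by_cases hxa : x = a
        · exact ⟨k, by rw [hZk, hxa]; exact mem_insert_self _ _⟩
        · refine ⟨i, ?_⟩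
          by_cases hik : i = k
          · subst hik; rw [hZk]; exact mem_insert_of_mem hi
          · rw [hZi i hik]; exact mem_erase.2 ⟨hxa, hi⟩
      have hZpot : ∑ i, (Y i ∩ A i).card < ∑ i, (Z i ∩ A i).card := by
        refine sum_lt_sum (fun i _ => ?_) ⟨k, mem_univ k, ?_⟩
        · apply card_le_card
          intro x hx
          rw [mem_inter] at hx ⊢
          refine ⟨?_, hx.2⟩
          by_cases hik : i = k
          · subst hik; rw [hZk]; exact mem_insert_of_mem hx.1
          · rw [hZi i hik]
            refine mem_erase.2 ⟨?_, hx.1⟩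
            rintro rfl
            exact Finset.disjoint_left.1 (hA.2 i k hik) hx.2 haA
        · rw [hZk, insert_inter_of_mem haA, card_insert_of_notMem]
          · omega
          · exact fun h => haY (mem_inter.1 h).1
      by_cases hj : ∃ j, j ≠ k ∧ a ∈ Y j
      · obtain ⟨j, hjk, haj⟩ := hj
        refine ih Z j hZalloc hZnr (fun i hij => ?_) ?_ (by omega) (by omega)
        · by_cases hik : i = k
          · subst hik; omega
          · rw [hZi i hik, erase_eq_of_notMem]
            · exact hge i hik
            · exact fun h => Finset.disjoint_left.1 (hY.2 i j hij) h haj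
        · rw [hZi j hjk, card_erase_add_one haj]
          exact hge j hjk
      · refine ih Z k hZalloc hZnr (fun i hik => ?_) (by omega) (by omega) (by omega)
        rw [hZi i hik, erase_eq_of_notMem]
        · exact hge i hik
        · exact fun h => hj ⟨i, hik, h⟩

/-- With an extra agent `0` valuing only the good `g`, if `X` is non-redundant with `X_0 = ∅`
and `A` is Pareto-optimal non-redundant, and either some agent `h ≠ 0` has `|X_h| > |A_h| + 1`
or two distinct agents `h, h' ≠ 0` lie in `H(X, A)`, then `L(X, A)` contains an agent other
than agent `0`. -/
theorem boundOneAgent {γ : Type} [DecidableEq γ] {n : ℕ} (M : Finset γ)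
    (g : γ) (hgM : g ∈ M)
    (v : Fin (n + 1) → Finset γ → ℕ) (hv : ∀ i, MatroidRank M (v i))
    (hv0 : v 0 = fun S => if g ∈ S then 1 else 0)
    (w : Fin (n + 1) → ℝ) (hw : ∀ i, 0 < w i)
    (X A : Fin (n + 1) → Finset γ)
    (hX : IsAlloc (n + 1) M X) (hXnr : NonRedundant (n + 1) v X) (hX0 : (X 0).card = 0)
    (hA : IsAlloc (n + 1) M A) (hAnr : NonRedundant (n + 1) v A)
    (hApo : ParetoOptimal (n + 1) M v A)
    (hhyp : (∃ h : Fin (n + 1), h ≠ 0 ∧ (A h).card + 1 < (X h).card) ∨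
      (∃ h h' : Fin (n + 1), h ≠ 0 ∧ h' ≠ 0 ∧ h ≠ h' ∧
        (A h).card < (X h).card ∧ (A h').card < (X h').card)) :
    ∃ ℓ : Fin (n + 1), ℓ ≠ 0 ∧ (X ℓ).card < (A ℓ).card := by
  by_contra hcon
  have hge : ∀ i, i ≠ 0 → (A i).card ≤ (X i).card := by
    intro i hi
    by_contra h
    exact hcon ⟨i, hi, by omega⟩
  have hA0 : (A 0).card ≤ 1 := by
    rw [← hAnr 0, hv0]
    dsimp only
    split_ifs <;> omega
  have hgeS : ∀ i : Fin n, (A i.succ).card ≤ (X i.succ).card :=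
    fun i => hge _ (Fin.succ_ne_zero i)
  have hsum : ∑ i, (A i).card < ∑ i, (X i).card := by
    rw [Fin.sum_univ_succ, Fin.sum_univ_succ (fun i => (X i).card)]
    suffices h : ∑ i : Fin n, (A i.succ).card + 2 ≤ ∑ i : Fin n, (X i.succ).card by omega
    rcases hhyp with ⟨h, h0, hlt⟩ | ⟨h, h', h0, h0', hne, hlt, hlt'⟩
    · obtain ⟨h, rfl⟩ := Fin.exists_succ_eq.2 h0
      have e : ∑ i : Fin n, ((A i.succ).card + if i = h then 2 else 0)
          ≤ ∑ i : Fin n, (X i.succ).card := by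
        refine sum_le_sum (fun i _ => ?_)
        have := hgeS i
        split_ifs with hi
        · subst hi; omega
        · omega
      simpa [sum_add_distrib] using e
    · obtain ⟨h, rfl⟩ := Fin.exists_succ_eq.2 h0
      obtain ⟨h', rfl⟩ := Fin.exists_succ_eq.2 h0'
      have hne' : h ≠ h' := fun e => hne (by rw [e])
      have e : ∑ i : Fin n, ((A i.succ).card + ((if i = h then 1 else 0) +
          (if i = h' then 1 else 0))) ≤ ∑ i : Fin n, (X i.succ).card := by
        refine sum_le_sum (fun i _ => ?_)
        have := hgeS i
        split_ifs with hi hi' hi'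
        · exact absurd (hi.symm.trans hi') hne'
        · subst hi; omega
        · subst hi'; omega
        · omega
      simpa [sum_add_distrib] using e
  exact augment_aux M v hv A hA hAnr hApo (∑ i, (A i).card) X 0 hX hXnr hge (by omega) hsum
    (by omega)
end

section
/- Let f be strictly increasing and concave, and let I and I' be instances with agents N, positive weights, and matroid-rank valuations such that I' is obtained from I by adding one extra good g. Let A be an R^tie_f allocation of I and A' an R^tie_f allocation of I'. Let I* be obtained from I' by adding an extra agent 0 with an arbitrary positive weight and binary additive valuation v_0 with v_0({g}) = 1 and v_0({ḡ}) = 0 for all ḡ ≠ g, and let Â be the allocation in I* that agrees with A on N and has the additional bundle Â_0 = {g}. If g ∈ F_i(Â_i) for some i ∈ N, or there exists a directed path with at least one edge in the exchange graph G(Â) that begins at some good g' ∈ F_i(Â_i) for some i ∈ N and ends at g ∈ Â_0, then there is exactly one agent z ∈ N with |A'_z| = |A_z| + 1, and |A'_y| = |A_y| for all y ∈ N ∖ {z}. -/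
open Finset

set_option linter.unusedSectionVars false

namespace PAO

section mr
variable {γ : Type} [DecidableEq γ] {M : Finset γ} {v : Finset γ → ℕ}

lemma mr_mono (h : MatroidRank M v) {S T : Finset γ} (hST : S ⊆ T) (hT : T ⊆ M) : v S ≤ v T :=
  h.2.1 S T hST hT

lemma mr_aux (h : MatroidRank M v) {S T : Finset γ} (hST : S ⊆ T) (hT : T ⊆ M)
    (C : Finset γ) : C ⊆ M → v (T ∪ C) + v S ≤ v (S ∪ C) + v T := by
  induction C using Finset.induction_on with
  | empty => intro _; simp; omega
  | insert c C hc ih =>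
    intro hC
    have hcM : c ∈ M := hC (mem_insert_self _ _)
    have hCM : C ⊆ M := fun x hx => hC (mem_insert_of_mem hx)
    have ih := ih hCM
    rw [union_insert, union_insert]
    by_cases hcT : c ∈ T ∪ C
    · rw [insert_eq_of_mem hcT]
      have : v (S ∪ C) ≤ v (insert c (S ∪ C)) := mr_mono h (subset_insert _ _)
        (insert_subset hcM (union_subset (hST.trans hT) hCM))
      omega
    · have := h.2.2.1 (S ∪ C) (T ∪ C) (union_subset_union_left hST) (union_subset hT hCM) c hcM hcT
      omega

lemma mr_submod (h : MatroidRank M v) {A B : Finset γ} (hA : A ⊆ M) (hB : B ⊆ M) :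
    v (A ∪ B) + v (A ∩ B) ≤ v A + v B := by
  have := mr_aux h (S := A ∩ B) (T := A) inter_subset_left hA B hB
  rw [union_eq_right.2 (inter_subset_right : A ∩ B ⊆ B)] at this
  omega

lemma mr_insert_le (h : MatroidRank M v) {S : Finset γ} {a : γ} (hS : S ⊆ M) (ha : a ∈ M) :
    v (insert a S) ≤ v S + 1 := by
  by_cases haS : a ∈ S
  · rw [insert_eq_of_mem haS]; omega
  · rcases h.1 S hS a ha haS with h | h <;> omega

lemma mr_card (h : MatroidRank M v) (S : Finset γ) : S ⊆ M → v S ≤ S.card := by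
  induction S using Finset.induction_on with
  | empty => intro _; rw [h.2.2.2]; simp
  | insert c C hc ih =>
    intro hC
    have hcM : c ∈ M := hC (mem_insert_self _ _)
    have hCM : C ⊆ M := fun x hx => hC (mem_insert_of_mem hx)
    have := mr_insert_le h hCM hcM
    have := ih hCM
    rw [card_insert_of_notMem hc]; omega

/-- subsets of independent sets are independent -/
lemma mr_indep_subset (h : MatroidRank M v) {S T : Finset γ} (hST : S ⊆ T) (hT : T ⊆ M)
    (hi : v T = T.card) : v S = S.card := by
  have h1 := mr_submod h (A := S) (B := T \ S) (hST.trans hT) (sdiff_subset.trans hT)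
  rw [union_sdiff_of_subset hST] at h1
  have h2 := mr_card h (T \ S) (sdiff_subset.trans hT)
  have h3 := mr_card h S (hST.trans hT)
  have h4 := card_sdiff_add_card_eq_card hST
  omega

lemma mr_extract (h : MatroidRank M v) (S : Finset γ) : S ⊆ M → ∀ k ≤ v S,
    ∃ T ⊆ S, v T = k ∧ T.card = k := by
  induction S using Finset.induction_on with
  | empty =>
    intro _ k hk
    rw [h.2.2.2] at hk
    exact ⟨∅, subset_rfl, by rw [h.2.2.2]; omega, by simp; omega⟩
  | insert c C hc ih =>
    intro hC k hk
    have hcM : c ∈ M := hC (mem_insert_self _ _)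
    have hCM : C ⊆ M := fun x hx => hC (mem_insert_of_mem hx)
    have ih := ih hCM
    by_cases hk' : k ≤ v C
    · obtain ⟨T, hT, h1⟩ := ih k hk'
      exact ⟨T, hT.trans (subset_insert _ _), h1⟩
    · obtain ⟨T, hT, h1, h2⟩ := ih _ le_rfl
      have h3 := mr_insert_le h hCM hcM
      have h4 := h.2.2.1 T C hT hCM c hcM hc
      have h5 := mr_insert_le h (hT.trans hCM) hcM
      refine ⟨insert c T, insert_subset_insert _ hT, by omega, ?_⟩
      rw [card_insert_of_notMem (fun hx => hc (hT hx))]; omega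

lemma mr_trunc (h : MatroidRank M v) (u : ℕ) {A B X Y : Finset γ} (hA : A ⊆ M) (hB : B ⊆ M)
    (hX : X ⊆ A ∪ B) (hY : Y ⊆ A ∩ B) :
    min u (v X) + min u (v Y) ≤ min u (v A) + min u (v B) := by
  have h1 := mr_submod h hA hB
  have h2 := mr_mono h hX (union_subset hA hB)
  have h3 := mr_mono h hY (inter_subset_left.trans hA)
  have h4 := mr_mono h (inter_subset_left : A ∩ B ⊆ A) hA
  have h5 := mr_mono h (inter_subset_right : A ∩ B ⊆ B) hB
  omega

end mr

section rado
variable {γ : Type} [DecidableEq γ] {ι : Type} [Fintype ι] [DecidableEq ι]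
  {M : Finset γ} {r : ι → Finset γ → ℕ}

lemma rado_aux (hr : ∀ i, MatroidRank M (r i)) (u : ι → ℕ) (N : ℕ) :
    ∀ Gs : ι → Finset γ, (∑ i, (Gs i).card = N) → (∀ i, Gs i ⊆ M) →
    (∀ S ⊆ M, ∑ i, u i ≤ (M \ S).card + ∑ i, min (u i) (r i (S ∩ Gs i))) →
    ∃ B : ι → Finset γ, (∀ i, B i ⊆ M) ∧ (∀ i j, i ≠ j → Disjoint (B i) (B j)) ∧
      ∀ i, r i (B i) = u i ∧ (B i).card = u i := by
  induction N using Nat.strong_induction_on with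
  | _ N ih =>
  intro Gs hN hGs hc
  by_cases hd : ∀ i j, i ≠ j → Disjoint (Gs i) (Gs j)
  · have h1 : ∀ i, u i ≤ r i (Gs i) := by
      have h2 := hc M subset_rfl
      simp only [sdiff_self, bot_eq_empty, card_empty, zero_add] at h2
      intro i
      have h3 : ∑ i, min (u i) (r i (M ∩ Gs i)) ≤ ∑ i, u i :=
        sum_le_sum fun i _ => min_le_left _ _
      have h4 := (sum_eq_sum_iff_of_le (fun i _ => min_le_left (u i) (r i (M ∩ Gs i)))).1
        (le_antisymm h3 h2) i (mem_univ i)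
      rw [inter_eq_right.2 (hGs i)] at h4
      omega
    choose B hB1 hB2 using fun i => mr_extract (hr i) (Gs i) (hGs i) (u i) (h1 i)
    exact ⟨B, fun i => (hB1 i).trans (hGs i),
      fun i j hij => (hd i j hij).mono (hB1 i) (hB1 j), hB2⟩
  · push Not at hd
    obtain ⟨i, j, hij, hd⟩ := hd
    rw [not_disjoint_iff] at hd
    obtain ⟨h, hi, hj⟩ := hd
    have key : ∀ k, h ∈ Gs k →
        (∀ S ⊆ M, ∑ i, u i ≤ (M \ S).card +
          ∑ i, min (u i) (r i (S ∩ (Function.update Gs k ((Gs k).erase h)) i))) →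
        ∃ B : ι → Finset γ, (∀ i, B i ⊆ M) ∧ (∀ i j, i ≠ j → Disjoint (B i) (B j)) ∧
        ∀ i, r i (B i) = u i ∧ (B i).card = u i := by
      intro k hk hS
      refine ih _ ?_ (Function.update Gs k ((Gs k).erase h)) rfl ?_ hS
      · rw [← hN]
        apply sum_lt_sum
        · intro l _
          by_cases hl : l = k
          · subst hl; simp [card_erase_le]
          · simp [hl]
        · exact ⟨k, mem_univ _, by simpa using card_erase_lt_of_mem hk⟩
      · intro l
        by_cases hl : l = k
        · subst hl; simpa using (erase_subset _ _).trans (hGs l)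
        · simpa [hl] using hGs l
    by_contra hcon
    have k1 := mt (key i hi) hcon
    have k2 := mt (key j hj) hcon
    push Not at k1 k2
    obtain ⟨S1, hS1, k1⟩ := k1
    obtain ⟨S2, hS2, k2⟩ := k2
    have hmem : ∀ k (S : Finset γ), S ⊆ M → (M \ S).card +
          ∑ i, min (u i) (r i (S ∩ (Function.update Gs k ((Gs k).erase h)) i)) < ∑ i, u i →
          h ∈ S := by
      intro k S hS hlt
      by_contra hh
      have := hc S hS
      have e : ∀ l, S ∩ (Function.update Gs k ((Gs k).erase h)) l = S ∩ Gs l := by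
        intro l
        by_cases hl : l = k
        · subst hl
          ext x
          simp only [Function.update_self, mem_inter, mem_erase]
          constructor
          · tauto
          · rintro ⟨a, b⟩
            exact ⟨a, fun hx => hh (hx ▸ a), b⟩
        · simp [hl]
      simp only [e] at hlt
      omega
    have m1 := hmem i S1 hS1 k1
    have m2 := hmem j S2 hS2 k2
    have c1 := hc (S1 ∪ S2) (union_subset hS1 hS2)
    have c2 := hc ((S1 ∩ S2).erase h) ((erase_subset _ _).trans (inter_subset_left.trans hS1))
    have t : ∑ l, min (u l) (r l ((S1 ∪ S2) ∩ Gs l)) +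
        ∑ l, min (u l) (r l ((S1 ∩ S2).erase h ∩ Gs l)) ≤
        ∑ l, min (u l) (r l (S1 ∩ (Function.update Gs i ((Gs i).erase h)) l)) +
        ∑ l, min (u l) (r l (S2 ∩ (Function.update Gs j ((Gs j).erase h)) l)) := by
      rw [← sum_add_distrib, ← sum_add_distrib]
      apply sum_le_sum
      intro l _
      apply mr_trunc (hr l) _ (inter_subset_left.trans hS1) (inter_subset_left.trans hS2)
      · intro x hx
        simp only [mem_inter, mem_union, Function.update_apply] at hx ⊢
        by_cases hxh : x = h
        · subst hxh
          by_cases hl : l = i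
          · subst hl
            simp [hij, m2, hi]
          · simp [hl, m1, hx.2]
        · rcases hx with ⟨hx1, hx2⟩
          have q : ∀ k, x ∈ (if l = k then (Gs k).erase h else Gs l) := by
            intro k
            split_ifs with hk
            · exact mem_erase.2 ⟨hxh, hk ▸ hx2⟩
            · exact hx2
          exact hx1.imp (fun a => ⟨a, q i⟩) (fun a => ⟨a, q j⟩)
      · intro x hx
        simp only [mem_inter, mem_erase, Function.update_apply] at hx ⊢
        obtain ⟨⟨hxh, hx1, hx1'⟩, hx2⟩ := hx
        have q : ∀ k, x ∈ (if l = k then (Gs k).erase h else Gs l) := by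
          intro k
          split_ifs with hk
          · exact mem_erase.2 ⟨hxh, hk ▸ hx2⟩
          · exact hx2
        exact ⟨⟨hx1, q i⟩, hx1', q j⟩
    have d1 := card_sdiff_add_card_eq_card hS1
    have d2 := card_sdiff_add_card_eq_card hS2
    have d3 := card_sdiff_add_card_eq_card (union_subset hS1 hS2)
    have d4 := card_sdiff_add_card_eq_card
      ((erase_subset h (S1 ∩ S2)).trans (inter_subset_left.trans hS1))
    have d5 := card_union_add_card_inter S1 S2
    have d6 := card_erase_add_one (mem_inter.2 ⟨m1, m2⟩)
    omega

/-- the polymatroid bound -/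
def HH (M : Finset γ) (r : ι → Finset γ → ℕ) (X : Finset ι) (S : Finset γ) : ℤ :=
  (M \ S).card + ∑ i ∈ X, (r i S : ℤ)

lemma HH_submod (hr : ∀ i, MatroidRank M (r i)) (X1 X2 : Finset ι) {S1 S2 : Finset γ}
    (h1 : S1 ⊆ M) (h2 : S2 ⊆ M) :
    HH M r (X1 ∪ X2) (S1 ∩ S2) + HH M r (X1 ∩ X2) (S1 ∪ S2) ≤ HH M r X1 S1 + HH M r X2 S2 := by
  unfold HH
  have d1 := card_sdiff_add_card_eq_card h1
  have d2 := card_sdiff_add_card_eq_card h2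
  have d3 := card_sdiff_add_card_eq_card (union_subset h1 h2)
  have d4 := card_sdiff_add_card_eq_card (inter_subset_left.trans h1 : S1 ∩ S2 ⊆ M)
  have d5 := card_union_add_card_inter S1 S2
  have t : ∑ i ∈ X1 ∪ X2, (r i (S1 ∩ S2) : ℤ) + ∑ i ∈ X1 ∩ X2, (r i (S1 ∪ S2) : ℤ) ≤
      ∑ i ∈ X1, (r i S1 : ℤ) + ∑ i ∈ X2, (r i S2 : ℤ) := by
    have e : ∀ (X : Finset ι) (q : ι → ℤ), ∑ i ∈ X, q i = ∑ i, if i ∈ X then q i else 0 := by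
      intro X q; simp
    rw [e, e (X1 ∩ X2), e X1, e X2, ← sum_add_distrib, ← sum_add_distrib]
    apply sum_le_sum
    intro i _
    have s := mr_submod (hr i) h1 h2
    have s1 := mr_mono (hr i) (inter_subset_left : S1 ∩ S2 ⊆ S1) h1
    have s2 := mr_mono (hr i) (inter_subset_right : S1 ∩ S2 ⊆ S2) h2
    by_cases a : i ∈ X1 <;> by_cases b : i ∈ X2 <;> simp [a, b] <;> omega
  omega

/-- rank function of the polymatroid of achievable utility vectors -/
noncomputable def rho (M : Finset γ) (r : ι → Finset γ → ℕ) (X : Finset ι) : ℤ :=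
  M.powerset.inf' ⟨M, mem_powerset_self M⟩ (HH M r X)

lemma rho_le (X : Finset ι) {S : Finset γ} (hS : S ⊆ M) : rho M r X ≤ HH M r X S :=
  inf'_le _ (mem_powerset.2 hS)

lemma rho_exists (M : Finset γ) (r : ι → Finset γ → ℕ) (X : Finset ι) :
    ∃ S ⊆ M, rho M r X = HH M r X S := by
  obtain ⟨S, hS, h⟩ := exists_mem_eq_inf' (⟨M, mem_powerset_self M⟩ : M.powerset.Nonempty)
    (HH M r X)
  exact ⟨S, mem_powerset.1 hS, h⟩

lemma rho_submod (hr : ∀ i, MatroidRank M (r i)) (X Y : Finset ι) :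
    rho M r (X ∪ Y) + rho M r (X ∩ Y) ≤ rho M r X + rho M r Y := by
  obtain ⟨S1, h1, e1⟩ := rho_exists M r X
  obtain ⟨S2, h2, e2⟩ := rho_exists M r Y
  have := HH_submod hr X Y h1 h2
  have := rho_le (r := r) (X ∪ Y) (inter_subset_left.trans h1 : S1 ∩ S2 ⊆ M)
  have := rho_le (r := r) (X ∩ Y) (union_subset h1 h2)
  omega

/-- membership in polymatroid -/
def InP (ρ : Finset ι → ℤ) (u : ι → ℤ) : Prop := ∀ X, ∑ i ∈ X, u i ≤ ρ X

lemma inP_of_alloc (hr : ∀ i, MatroidRank M (r i)) (B : ι → Finset γ)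
    (hB : ∀ i, B i ⊆ M) (hd : ∀ i j, i ≠ j → Disjoint (B i) (B j))
    (hn : ∀ i, r i (B i) = (B i).card) : InP (rho M r) (fun i => ((B i).card : ℤ)) := by
  intro X
  obtain ⟨S, hS, e⟩ := rho_exists M r X
  rw [e]
  unfold HH
  beta_reduce
  have h1 : ∑ i ∈ X, (B i \ S).card ≤ (M \ S).card := by
    rw [← card_biUnion]
    · apply card_le_card
      intro x hx
      simp only [mem_biUnion, mem_sdiff] at hx ⊢
      obtain ⟨i, _, h2, h3⟩ := hx
      exact ⟨hB i h2, h3⟩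
    · intro i _ j _ hij
      exact (hd i j hij).mono sdiff_subset sdiff_subset
  have h2 : ∑ i ∈ X, (B i ∩ S).card ≤ ∑ i ∈ X, r i S := by
    apply sum_le_sum
    intro i _
    rw [← mr_indep_subset (hr i) inter_subset_left (hB i) (hn i)]
    exact mr_mono (hr i) inter_subset_right hS
  have h3 : ∑ i ∈ X, (B i).card = ∑ i ∈ X, (B i \ S).card + ∑ i ∈ X, (B i ∩ S).card := by
    rw [← sum_add_distrib]
    exact sum_congr rfl fun i _ => (card_sdiff_add_card_inter _ _).symm
  exact_mod_cast (by omega : ∑ i ∈ X, (B i).card ≤ (M \ S).card + ∑ i ∈ X, r i S)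

lemma alloc_of_inP (hr : ∀ i, MatroidRank M (r i)) (u : ι → ℕ)
    (hu : InP (rho M r) (fun i => (u i : ℤ))) :
    ∃ B : ι → Finset γ, (∀ i, B i ⊆ M) ∧ (∀ i j, i ≠ j → Disjoint (B i) (B j)) ∧
      ∀ i, r i (B i) = u i ∧ (B i).card = u i := by
  refine rado_aux hr u _ (fun _ => M) rfl (fun _ => subset_rfl) ?_
  intro S hS
  simp only [inter_eq_left.2 hS]
  have h1 := (hu (univ.filter fun i => r i S < u i)).trans (rho_le _ hS)
  unfold HH at h1
  beta_reduce at h1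
  have h1 : ∑ i ∈ univ.filter (fun i => r i S < u i), u i ≤
    (M \ S).card + ∑ i ∈ univ.filter (fun i => r i S < u i), r i S := by exact_mod_cast h1
  rw [← sum_filter_add_sum_filter_not univ (fun i => r i S < u i) u,
    ← sum_filter_add_sum_filter_not univ (fun i => r i S < u i) (fun i => min (u i) (r i S))]
  have h2 : ∑ i ∈ univ.filter (fun i => r i S < u i), min (u i) (r i S) =
      ∑ i ∈ univ.filter (fun i => r i S < u i), r i S :=
    sum_congr rfl fun i hi => by simp at hi; omega
  have h3 : ∑ i ∈ univ.filter (fun i => ¬ r i S < u i), min (u i) (r i S) =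
      ∑ i ∈ univ.filter (fun i => ¬ r i S < u i), u i :=
    sum_congr rfl fun i hi => by simp at hi; omega
  omega

end rado

section poly
variable {ι : Type} [Fintype ι] [DecidableEq ι] {ρ : Finset ι → ℤ}

lemma tight_union (hρ : ∀ X Y, ρ (X ∪ Y) + ρ (X ∩ Y) ≤ ρ X + ρ Y) {u : ι → ℤ} (hu : InP ρ u)
    {X Y : Finset ι} (hX : ∑ i ∈ X, u i = ρ X) (hY : ∑ i ∈ Y, u i = ρ Y) :
    ∑ i ∈ X ∪ Y, u i = ρ (X ∪ Y) ∧ ∑ i ∈ X ∩ Y, u i = ρ (X ∩ Y) := by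
  have h1 := hρ X Y
  have h2 := hu (X ∪ Y)
  have h3 := hu (X ∩ Y)
  have h4 := sum_union_inter (s₁ := X) (s₂ := Y) (f := u)
  constructor <;> linarith

lemma sum_single (X : Finset ι) (i : ι) :
    ∑ l ∈ X, (Pi.single i 1 : ι → ℤ) l = if i ∈ X then 1 else 0 := by
  simp [Pi.single_apply]

/-- if no element of `J` can be incremented, a tight set contains `J` (`J` nonempty). -/
lemma tight_cover (hρ : ∀ X Y, ρ (X ∪ Y) + ρ (X ∩ Y) ≤ ρ X + ρ Y) {u : ι → ℤ} (hu : InP ρ u)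
    (J : Finset ι) (hne : J.Nonempty) (hJ : ∀ j ∈ J, ¬ InP ρ (u + Pi.single j 1)) :
    ∃ X, J ⊆ X ∧ ∑ i ∈ X, u i = ρ X := by
  have h1 : ∀ j ∈ J, ∃ X, j ∈ X ∧ ∑ i ∈ X, u i = ρ X := by
    intro j hj
    have := hJ j hj
    unfold InP at this
    push Not at this
    obtain ⟨X, hX⟩ := this
    refine ⟨X, ?_⟩
    have h2 := hu X
    simp only [Pi.add_apply, sum_add_distrib, sum_single] at hX
    by_cases hjX : j ∈ X
    · rw [if_pos hjX] at hX
      exact ⟨hjX, by omega⟩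
    · rw [if_neg hjX] at hX
      omega
  clear hJ
  induction hne using Finset.Nonempty.cons_induction with
  | singleton a =>
    obtain ⟨X, h2, h3⟩ := h1 a (by simp)
    exact ⟨X, by simpa using h2, h3⟩
  | cons a s ha hs ih =>
    obtain ⟨X, h2, h3⟩ := h1 a (by simp)
    obtain ⟨Y, h4, h5⟩ := ih (fun j hj => h1 j (by simp [hj]))
    refine ⟨X ∪ Y, ?_, (tight_union hρ hu h3 h5).1⟩
    intro x hx
    rw [mem_cons] at hx
    rcases hx with rfl | hx
    · exact mem_union_left _ h2
    · exact mem_union_right _ (h4 hx)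

lemma exchange (hρ : ∀ X Y, ρ (X ∪ Y) + ρ (X ∩ Y) ≤ ρ X + ρ Y) {x y : ι → ℤ}
    (hx : InP ρ x) (hy : InP ρ y) (i : ι) (hi : y i < x i) :
    InP ρ (y + Pi.single i 1) ∨ ∃ j, x j < y j ∧ InP ρ (x - Pi.single i 1 + Pi.single j 1) ∧
      InP ρ (y + Pi.single i 1 - Pi.single j 1) := by
  classical
  by_cases h1 : InP ρ (y + Pi.single i 1)
  · exact Or.inl h1
  right
  -- minimal tight set
  obtain ⟨D0, hD0, hD0t⟩ := tight_cover hρ hy {i} (by simp) (by simpa using h1)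
  obtain ⟨D, hD, hmin⟩ := exists_min_image
    (univ.filter fun D : Finset ι => i ∈ D ∧ ∑ l ∈ D, y l = ρ D) card
    ⟨D0, by simpa using ⟨by simpa using hD0, hD0t⟩⟩
  simp only [mem_filter, mem_univ, true_and] at hD hmin
  have hyD : ∀ j ∈ D, InP ρ (y + Pi.single i 1 - Pi.single j 1) := by
    intro j hj
    by_contra hcon
    unfold InP at hcon
    push Not at hcon
    obtain ⟨X, hX⟩ := hcon
    simp only [Pi.add_apply, Pi.sub_apply, sum_add_distrib, sum_sub_distrib, sum_single] at hX
    have h2 := hy X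
    have h3 : i ∈ X ∧ j ∉ X ∧ ∑ l ∈ X, y l = ρ X := by
      by_cases a : i ∈ X <;> by_cases b : j ∈ X <;> simp only [a, b, if_true, if_false] at hX <;>
        first | omega | exact ⟨a, b, by omega⟩
    have h4 := (tight_union hρ hy hD.2 h3.2.2).2
    have h5 := hmin (D ∩ X) ⟨mem_inter.2 ⟨hD.1, h3.1⟩, h4⟩
    have h6 : (D ∩ X).card < D.card := by
      apply card_lt_card
      rw [ssubset_iff_of_subset inter_subset_left]
      exact ⟨j, hj, fun h => h3.2.1 (mem_inter.1 h).2⟩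
    omega
  by_contra hcon
  push Not at hcon
  have hx' : InP ρ (x - Pi.single i 1) := by
    intro X
    simp only [Pi.sub_apply, sum_sub_distrib, sum_single]
    have := hx X
    split_ifs <;> omega
  set J := D.filter fun j => x j < y j with hJ
  have hJn : ∀ j ∈ J, ¬ InP ρ (x - Pi.single i 1 + Pi.single j 1) := by
    intro j hj h
    rw [hJ, mem_filter] at hj
    exact hcon j hj.2 h (hyD j hj.1)
  have hsum : ∀ Z ⊆ D, i ∈ Z → (∀ j ∈ Z, j ∉ J) → ∑ l ∈ Z, y l < ∑ l ∈ Z, x l := by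
    intro Z hZ hiZ hZJ
    apply sum_lt_sum
    · intro l hl
      have := hZJ l hl
      rw [hJ, mem_filter] at this
      by_contra h
      exact this ⟨hZ hl, by omega⟩
    · exact ⟨i, hiZ, hi⟩
  by_cases hne : J.Nonempty
  · obtain ⟨X, hX1, hX2⟩ := tight_cover hρ hx' J hne hJn
    simp only [Pi.sub_apply, sum_sub_distrib, sum_single] at hX2
    have h2 := hx X
    have hiX : i ∉ X := by
      intro h
      rw [if_pos h] at hX2
      omega
    rw [if_neg hiX] at hX2
    have h3 := hρ X D
    have h4 := hx (X ∪ D)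
    have h5 := hy (X ∩ D)
    have h6 := hsum (D \ X) sdiff_subset (mem_sdiff.2 ⟨hD.1, hiX⟩)
      (fun j hj h => (mem_sdiff.1 hj).2 (hX1 h))
    have h7 : ∑ l ∈ X ∪ D, x l = ∑ l ∈ X, x l + ∑ l ∈ D \ X, x l := by
      rw [← union_sdiff_self_eq_union, sum_union disjoint_sdiff]
    have h8 : ∑ l ∈ D, y l = ∑ l ∈ X ∩ D, y l + ∑ l ∈ D \ X, y l := by
      rw [inter_comm, sum_inter_add_sum_sdiff]
    linarith [hD.2]
  · have h2 := hsum D subset_rfl hD.1 (fun j _ h => hne ⟨j, h⟩)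
    have h3 := hx D
    linarith [hD.2]

end poly
end PAO

namespace PAO

section phi
variable {n : ℕ}

/-- the lexicographic value group -/
abbrev Gam (n : ℕ) : Type := ℤ ×ₗ (Lex (Fin n → ℤ)) ×ₗ ℝ ×ₗ (Lex (Fin n → ℤ))

open Classical in
/-- indicator that `f k` is finite -/
noncomputable def ind (f : ℕ → EReal) (k : ℕ) : ℤ := if f k = ⊥ then 0 else 1

/-- agentwise lexicographic value -/
noncomputable def phi (w : Fin n → ℝ) (f : ℕ → EReal) (i : Fin n) (k : ℕ) : Gam n :=
  toLex (ind f k, toLex (toLex (Pi.single i (ind f k)),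
    toLex (w i * (f k).toReal, toLex (Pi.single i (k : ℤ)))))

/-- total lexicographic value -/
noncomputable def Phi (w : Fin n → ℝ) (f : ℕ → EReal) (b : Fin n → ℕ) : Gam n :=
  ∑ i, phi w f i (b i)

lemma sum_toLex_prod {ι α β : Type} [AddCommMonoid α] [AddCommMonoid β] (s : Finset ι)
    (a : ι → α) (b : ι → β) :
    ∑ i ∈ s, (toLex (a i, b i) : α ×ₗ β) = toLex (∑ i ∈ s, a i, ∑ i ∈ s, b i) := by
  classical
  induction s using Finset.induction_on with
  | empty => rfl
  | insert x s hx ih => rw [sum_insert hx, sum_insert hx, sum_insert hx, ih]; rfl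

lemma sum_toLex_single (a : Fin n → ℤ) :
    ∑ i, (toLex (Pi.single i (a i)) : Lex (Fin n → ℤ)) = toLex a := by
  have h : ∀ s : Finset (Fin n), ∑ i ∈ s, (toLex (Pi.single i (a i)) : Lex (Fin n → ℤ)) =
      toLex (∑ i ∈ s, Pi.single i (a i)) := by
    intro s
    induction s using Finset.induction_on with
    | empty => rfl
    | insert x s hx ih => rw [sum_insert hx, sum_insert hx, ih]; rfl
  rw [h, Finset.univ_sum_single]

lemma Phi_eq (w : Fin n → ℝ) (f : ℕ → EReal) (b : Fin n → ℕ) :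
    Phi w f b = toLex (∑ i, ind f (b i), toLex (toLex (fun i => ind f (b i)),
      toLex (∑ i, w i * (f (b i)).toReal, toLex (fun i => (b i : ℤ))))) := by
  unfold Phi phi
  rw [sum_toLex_prod, sum_toLex_prod, sum_toLex_prod, sum_toLex_single, sum_toLex_single]

lemma Phi_inj (w : Fin n → ℝ) (f : ℕ → EReal) {a b : Fin n → ℕ} (h : Phi w f a = Phi w f b) :
    a = b := by
  rw [Phi_eq, Phi_eq] at h
  have h1 := congrArg (fun x : Gam n => ofLex (ofLex (ofLex (ofLex x).2).2).2) h
  funext i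
  have := congrFun h1 i
  simpa using this

lemma lt_of_fst {α β : Type} [LinearOrder α] [LinearOrder β] {a c : α} {b d : β} (h : a < c) :
    (toLex (a, b) : α ×ₗ β) < toLex (c, d) := Prod.Lex.toLex_lt_toLex.2 (Or.inl h)

lemma le_of_le_le {α β : Type} [LinearOrder α] [LinearOrder β] {a c : α} {b d : β} (h : a ≤ c)
    (h' : a = c → b ≤ d) :
    (toLex (a, b) : α ×ₗ β) ≤ toLex (c, d) := Prod.Lex.toLex_le_toLex'.2 ⟨h, h'⟩

lemma lt_of_le_lt {α β : Type} [LinearOrder α] [LinearOrder β] {a c : α} {b d : β} (h : a ≤ c)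
    (h' : a = c → b < d) :
    (toLex (a, b) : α ×ₗ β) < toLex (c, d) := Prod.Lex.toLex_lt_toLex'.2 ⟨h, h'⟩

variable {w : Fin n → ℝ} {f : ℕ → EReal}

lemma f_ne_bot (hf : StrictMono f) {k : ℕ} (hk : 0 < k) : f k ≠ ⊥ :=
  (lt_of_le_of_lt bot_le (hf hk)).ne'

lemma f_coe (hftop : ∀ k, f k ≠ ⊤) {k : ℕ} (hk : f k ≠ ⊥) : f k = ((f k).toReal : EReal) :=
  (EReal.coe_toReal (hftop k) hk).symm

lemma ind_le (k : ℕ) : ind f k ≤ 1 := by unfold ind; split_ifs <;> simp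

lemma ind_nonneg (k : ℕ) : 0 ≤ ind f k := by unfold ind; split_ifs <;> simp

lemma phi_lt (hw : ∀ i, 0 < w i) (hf : StrictMono f) (hftop : ∀ k, f k ≠ ⊤) (i : Fin n) (k : ℕ) :
    phi w f i k < phi w f i (k + 1) := by
  have h1 : ind f (k + 1) = 1 := by simp [ind, f_ne_bot hf (Nat.succ_pos k)]
  unfold phi
  by_cases h : f k = ⊥
  · apply lt_of_fst
    rw [h1]; simp [ind, h]
  · have h0 : ind f k = 1 := by simp [ind, h]
    rw [h0, h1]
    refine lt_of_le_lt le_rfl fun _ => lt_of_le_lt le_rfl fun _ => lt_of_fst ?_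
    apply mul_lt_mul_of_pos_left _ (hw i)
    rw [← EReal.coe_lt_coe_iff, ← f_coe hftop h, ← f_coe hftop (f_ne_bot hf (Nat.succ_pos k))]
    exact hf (Nat.lt_succ_self k)

lemma phi_conc1 (hw : ∀ i, 0 < w i) (hf : StrictMono f) (hftop : ∀ k, f k ≠ ⊤)
    (hconc : ∀ k : ℕ, f (k + 2) + f k ≤ f (k + 1) + f (k + 1)) (i : Fin n) (k : ℕ) :
    phi w f i (k + 2) + phi w f i k ≤ phi w f i (k + 1) + phi w f i (k + 1) := by
  have h1 : ind f (k + 1) = 1 := by simp [ind, f_ne_bot hf (Nat.succ_pos k)]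
  have h2 : ind f (k + 2) = 1 := by simp [ind, f_ne_bot hf (Nat.succ_pos (k+1))]
  unfold phi
  have e : ∀ (a a' : ℤ) (b b' : Fin n → ℤ) (c c' : ℝ) (d d' : Fin n → ℤ),
      (toLex (a, toLex (toLex b, toLex (c, toLex d))) : Gam n) +
      toLex (a', toLex (toLex b', toLex (c', toLex d'))) =
      toLex (a + a', toLex (toLex (b + b'), toLex (c + c', toLex (d + d')))) := by
    intros; rfl
  rw [e, e]
  by_cases h : f k = ⊥
  · apply le_of_lt
    apply lt_of_fst
    rw [h1, h2]; simp [ind, h]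
  · have h0 : ind f k = 1 := by simp [ind, h]
    rw [h0, h1, h2]
    refine le_of_le_le le_rfl fun _ => le_of_le_le le_rfl fun _ => le_of_le_le ?_ fun _ => ?_
    · rw [← mul_add, ← mul_add]
      apply mul_le_mul_of_nonneg_left _ (hw i).le
      have := hconc k
      rw [f_coe hftop h, f_coe hftop (f_ne_bot hf (Nat.succ_pos k)),
        f_coe hftop (f_ne_bot hf (Nat.succ_pos (k + 1)))] at this
      exact_mod_cast this
    · apply le_of_eq
      congr 1
      rw [← Pi.single_add, ← Pi.single_add]
      congr 1
      push_cast; ring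

lemma phi_conc (hw : ∀ i, 0 < w i) (hf : StrictMono f) (hftop : ∀ k, f k ≠ ⊤)
    (hconc : ∀ k : ℕ, f (k + 2) + f k ≤ f (k + 1) + f (k + 1)) (i : Fin n) (a d : ℕ) :
    phi w f i (a + d + 1) + phi w f i a ≤ phi w f i (a + d) + phi w f i (a + 1) := by
  induction d with
  | zero => simp [add_comm]
  | succ d ih =>
    have h := phi_conc1 hw hf hftop hconc i (a + d)
    have h2 := add_le_add h ih
    rw [show a + d + 2 = a + (d + 1) + 1 by ring, show a + d + 1 = a + (d + 1) by ring] at h2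
    generalize phi w f i (a + (d + 1) + 1) = p at *
    generalize phi w f i (a + (d + 1)) = q at *
    generalize phi w f i (a + d) = s at *
    have h3 : (q + s) + (p + phi w f i a) ≤ (q + s) + (q + phi w f i (a + 1)) := by
      calc _ = p + s + (q + phi w f i a) := by abel
        _ ≤ _ := h2
        _ = _ := by abel
    exact le_of_add_le_add_left h3

lemma Phi_succ_lt (hw : ∀ i, 0 < w i) (hf : StrictMono f) (hftop : ∀ k, f k ≠ ⊤) (i : Fin n)
    (a : Fin n → ℕ) : Phi w f a < Phi w f (Function.update a i (a i + 1)) := by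
  apply sum_lt_sum
  · intro l _
    by_cases hl : l = i
    · subst hl; simpa using (phi_lt hw hf hftop l _).le
    · simp [hl]
  · exact ⟨i, mem_univ _, by simpa using phi_lt hw hf hftop i _⟩

/-- termwise comparison -/
lemma Phi_exch (hw : ∀ i, 0 < w i) (hf : StrictMono f) (hftop : ∀ k, f k ≠ ⊤)
    (hconc : ∀ k : ℕ, f (k + 2) + f k ≤ f (k + 1) + f (k + 1)) (x y x' y' : Fin n → ℕ)
    (h : ∀ l, (x' l = x l ∧ y' l = y l) ∨ (y l < x l ∧ x' l + 1 = x l ∧ y' l = y l + 1) ∨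
      (x l < y l ∧ y' l + 1 = y l ∧ x' l = x l + 1)) :
    Phi w f x + Phi w f y ≤ Phi w f x' + Phi w f y' := by
  unfold Phi
  rw [← sum_add_distrib, ← sum_add_distrib]
  apply sum_le_sum
  intro l _
  rcases h l with ⟨h1, h2⟩ | ⟨h0, h1, h2⟩ | ⟨h0, h1, h2⟩
  · rw [h1, h2]
  · obtain ⟨d, hd⟩ := Nat.exists_eq_add_of_lt h0
    have := phi_conc hw hf hftop hconc l (y l) d
    rw [h2, hd, show x' l = y l + d by omega]
    exact this
  · obtain ⟨d, hd⟩ := Nat.exists_eq_add_of_lt h0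
    have := phi_conc hw hf hftop hconc l (x l) d
    rw [h2, hd, show y' l = x l + d by omega, add_comm, add_comm (phi w f l (x l + 1))]
    exact this

lemma sum_bot {s : Finset (Fin n)} {q : Fin n → EReal} {i : Fin n} (hi : i ∈ s) (h : q i = ⊥) :
    ∑ i ∈ s, q i = ⊥ := by
  rw [← add_sum_erase s q hi, h, EReal.bot_add]

lemma sum_coe (hftop : ∀ k, f k ≠ ⊤) {s : Finset (Fin n)} {b : Fin n → ℕ}
    (h : ∀ i ∈ s, f (b i) ≠ ⊥) :
    ∑ i ∈ s, (w i : EReal) * f (b i) = ((∑ i ∈ s, w i * (f (b i)).toReal : ℝ) : EReal) := by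
  induction s using Finset.induction_on with
  | empty => simp
  | insert x s hx ih =>
    rw [sum_insert hx, sum_insert hx, ih (fun i hi => h i (mem_insert_of_mem hi)),
      f_coe hftop (h x (mem_insert_self _ _))]
    push_cast
    rfl

lemma tie_le {b u : Fin n → ℕ} (h : ¬ VecLexLt n u b) :
    (toLex (fun i => (b i : ℤ)) : Lex (Fin n → ℤ)) ≤ toLex (fun i => (u i : ℤ)) := by
  apply le_of_not_gt
  rintro ⟨i, h1, h2⟩
  refine h ⟨i, by simpa using h2, fun j hj => by simpa using h1 j hj⟩

variable {γ : Type} {M : Finset γ} {v : Fin n → Finset γ → ℕ} 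

lemma optimal (hw : ∀ i, 0 < w i) (hf : StrictMono f) (hftop : ∀ k, f k ≠ ⊤)
    {A : Fin n → Finset γ} (hA : IsRfTie n M w v f A) {B : Fin n → Finset γ}
    (hB : IsAlloc n M B) :
    Phi w f (fun i => v i (B i)) ≤ Phi w f (fun i => v i (A i)) := by
  obtain ⟨⟨hAa, hA1, hA2⟩, hA3, -⟩ := hA
  have welf_bot : ∀ C : Fin n → Finset γ, Welfare n w v f C = ⊥ → ∃ i, f (v i (C i)) = ⊥ := by
    intro C hC
    by_contra hcon
    push Not at hcon
    unfold Welfare at hC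
    rw [sum_coe hftop (fun i _ => hcon i)] at hC
    exact EReal.coe_ne_bot _ hC
  have welf_bot' : ∀ C : Fin n → Finset γ, (∃ i, f (v i (C i)) = ⊥) → Welfare n w v f C = ⊥ := by
    rintro C ⟨i, hi⟩
    exact sum_bot (mem_univ i) (by rw [hi, EReal.coe_mul_bot_of_pos (hw i)])
  rw [Phi_eq, Phi_eq]
  by_cases hc : ∃ B, IsAlloc n M B ∧ Welfare n w v f B ≠ ⊥
  · have hmax := hA1 hc
    have hWA : ∀ i, f (v i (A i)) ≠ ⊥ := by
      intro i hi
      obtain ⟨C, hC1, hC2⟩ := hc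
      have := hmax C hC1
      rw [welf_bot' A ⟨i, hi⟩] at this
      exact hC2 (le_bot_iff.1 this)
    have hiA : ∀ i, ind f (v i (A i)) = 1 := fun i => by simp [ind, hWA i]
    by_cases hWB : ∃ i, f (v i (B i)) = ⊥
    · obtain ⟨i, hi⟩ := hWB
      apply le_of_lt
      apply lt_of_fst
      apply sum_lt_sum
      · intro l _
        rw [hiA]; exact ind_le _
      · exact ⟨i, mem_univ i, by rw [hiA]; simp [ind, hi]⟩
    · push Not at hWB
      have hiB : ∀ i, ind f (v i (B i)) = 1 := fun i => by simp [ind, hWB i]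
      simp only [hiA, hiB]
      have hle := hmax B hB
      unfold Welfare at hle
      rw [sum_coe hftop (fun i _ => hWB i), sum_coe hftop (fun i _ => hWA i),
        EReal.coe_le_coe_iff] at hle
      refine le_of_le_le le_rfl fun _ => le_of_le_le le_rfl fun _ => le_of_le_le hle fun heq => ?_
      apply tie_le
      apply hA3 B
      refine ⟨hB, fun _ C hC => ?_, fun h => ?_⟩
      · refine (hmax C hC).trans (le_of_eq ?_)
        unfold Welfare
        rw [sum_coe hftop (fun i _ => hWB i), sum_coe hftop (fun i _ => hWA i), heq]
      · obtain ⟨C, hC1, hC2⟩ := hc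
        exact absurd (h C hC1) hC2
  · push Not at hc
    have hmax := hA2 hc
    have hf0 : f 0 = ⊥ := by
      obtain ⟨i, hi⟩ := welf_bot A (hc A hAa)
      exact le_bot_iff.1 (hi ▸ hf.monotone (Nat.zero_le _))
    have hind : ∀ (C : Fin n → Finset γ) i,
        ind f (v i (C i)) = if i ∈ PosAgents n v C then 1 else 0 := by
      intro C i
      simp only [PosAgents, mem_filter, mem_univ, true_and]
      by_cases h : 0 < v i (C i)
      · simp [ind, h, f_ne_bot hf h]
      · have : v i (C i) = 0 := by omega
        simp [ind, this, hf0]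
    have hcard : ∀ C : Fin n → Finset γ,
        ∑ i, ind f (v i (C i)) = ((PosAgents n v C).card : ℤ) := by
      intro C
      simp only [hind]
      simp
    have hrw : ∀ C : Fin n → Finset γ,
        RWelfare n w v f C = ((∑ i, w i * (f (v i (C i))).toReal : ℝ) : EReal) := by
      intro C
      unfold RWelfare
      rw [sum_coe hftop]
      · congr 1
        apply sum_subset (subset_univ _)
        intro i _ hi
        have : v i (C i) = 0 := by
          simp only [PosAgents, mem_filter, mem_univ, true_and] at hi
          omega
        simp [this, hf0]
      · intro i hi
        simp only [PosAgents, mem_filter, mem_univ, true_and] at hi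
        exact f_ne_bot hf hi
    obtain ⟨h1, h2⟩ := hmax B hB
    rw [hcard, hcard]
    rcases h1 with h1 | ⟨h1, h3⟩
    · exact le_of_lt (lt_of_fst (by exact_mod_cast h1))
    rw [h1]
    refine le_of_le_le le_rfl fun _ => ?_
    rcases h3 with h3 | ⟨i, hi1, hi2, hi3⟩
    · have e : (fun i => ind f (v i (B i))) = fun i => ind f (v i (A i)) := by
        funext i
        rw [hind, hind, h3]
      rw [e]
      have h4 := h2 h3.symm
      rw [hrw, hrw, EReal.coe_le_coe_iff] at h4
      refine le_of_le_le le_rfl fun _ => le_of_le_le h4 fun heq => ?_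
      apply tie_le
      apply hA3 B
      refine ⟨hB, fun ⟨C, hC1, hC2⟩ => absurd (hc C hC1) hC2, fun _ C hC => ?_⟩
      have h5 := hmax C hC
      rw [h3] at h5
      rw [hrw] at h5 ⊢
      rw [hrw] at h5 ⊢
      rw [heq]
      exact h5
    · apply le_of_lt
      apply lt_of_fst
      refine ⟨i, fun j hj => ?_, ?_⟩
      · show ind f (v j (B j)) = ind f (v j (A j))
        rw [hind, hind]
        simp [hi3 j hj]
      · show ind f (v i (B i)) < ind f (v i (A i))
        rw [hind, hind]
        simp [hi1, hi2]

end phi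
end PAO

namespace PAO

lemma chain_back {γ : Type} {R : γ → γ → Prop} {S : γ → Prop}
    (hR : ∀ a b, R a b → S b → S a) {g : γ} (hg : S g) :
    ∀ (P : List γ) (g' : γ), P.IsChain R → P.head? = some g' → P.getLast? = some g → S g' := by
  intro P
  induction P with
  | nil => intro g' _ h; simp at h
  | cons a t ih =>
    intro g' hc hh hl
    simp only [List.head?_cons, Option.some.injEq] at hh
    subst hh
    cases t with
    | nil =>
      simp only [List.getLast?_singleton, Option.some.injEq] at hl
      exact hl ▸ hg
    | cons b t =>
      rw [List.isChain_cons_cons] at hc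
      refine hR _ _ hc.1 (ih b hc.2 rfl ?_)
      simpa [List.getLast?_cons_cons] using hl

lemma path_inc {γ : Type} [DecidableEq γ] {n : ℕ} (M : Finset γ)
    (g : γ) (hg : g ∉ M)
    (v : Fin n → Finset γ → ℕ) (hv : ∀ i, MatroidRank (insert g M) (v i))
    (A : Fin n → Finset γ) (hAM : ∀ i, A i ⊆ insert g M) (hgA : ∀ i, g ∉ A i)
    (hAd : ∀ i j : Fin n, i ≠ j → Disjoint (A i) (A j))
    (hnr : ∀ i, v i (A i) = (A i).card)
    (vstar : Fin (n + 1) → Finset γ → ℕ)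
    (hvstar0 : vstar 0 = fun S => if g ∈ S then 1 else 0)
    (hvstarS : ∀ i : Fin n, vstar i.succ = v i)
    (Ahat : Fin (n + 1) → Finset γ)
    (hAhat0 : Ahat 0 = {g}) (hAhatS : ∀ i : Fin n, Ahat i.succ = A i)
    (hhyp : (∃ i : Fin n, FSet (insert g M) (v i) (A i) g) ∨
      ∃ (i : Fin n) (P : List γ) (g' : γ),
        P.IsChain (ExEdge (n + 1) (insert g M) vstar Ahat) ∧ 2 ≤ P.length ∧
        P.head? = some g' ∧ FSet (insert g M) (v i) (A i) g' ∧ P.getLast? = some g) :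
    ∃ i, InP (rho (insert g M) v) ((fun i => ((A i).card : ℤ)) + Pi.single i 1) := by
  by_contra hcon
  push Not at hcon
  have hn : (univ : Finset (Fin n)).Nonempty := by
    rcases hhyp with ⟨i, _⟩ | ⟨i, _⟩ <;> exact ⟨i, mem_univ i⟩
  obtain ⟨X, hX1, hX2⟩ := tight_cover (rho_submod hv) (inP_of_alloc hv A hAM hAd hnr) univ hn
    (fun j _ => hcon j)
  obtain rfl : X = univ := univ_subset_iff.1 hX1
  obtain ⟨S, hS, e⟩ := rho_exists (insert g M) v univ
  rw [e] at hX2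
  unfold HH at hX2
  have hX2 : ∑ i, (A i).card = ((insert g M) \ S).card + ∑ i, v i S := by exact_mod_cast hX2
  have hb : ((univ : Finset (Fin n)).biUnion fun i => A i \ S) ⊆ (insert g M) \ S := by
    intro x hx
    simp only [mem_biUnion, mem_sdiff] at hx ⊢
    obtain ⟨i, _, h2, h3⟩ := hx
    exact ⟨hAM i h2, h3⟩
  have hbc : ((univ : Finset (Fin n)).biUnion fun i => A i \ S).card = ∑ i, (A i \ S).card := by
    apply card_biUnion
    intro i _ j _ hij
    exact (hAd i j hij).mono sdiff_subset sdiff_subset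
  have h2 : ∀ i ∈ (univ : Finset (Fin n)), (A i ∩ S).card ≤ v i S := by
    intro i _
    rw [← mr_indep_subset (hv i) inter_subset_left (hAM i) (hnr i)]
    exact mr_mono (hv i) inter_subset_right hS
  have h3 : ∑ i, (A i).card = ∑ i, (A i \ S).card + ∑ i, (A i ∩ S).card := by
    rw [← sum_add_distrib]
    exact sum_congr rfl fun i _ => (card_sdiff_add_card_inter _ _).symm
  have h4 := card_le_card hb
  have h5 := sum_le_sum h2
  have h6 : ∀ i, (A i ∩ S).card = v i S := fun i =>
    (sum_eq_sum_iff_of_le h2).1 (by omega) i (mem_univ i)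
  have h7 := eq_of_subset_of_card_le hb (by omega)
  have hgS : g ∈ S := by
    by_contra h
    have : g ∈ insert g M \ S := mem_sdiff.2 ⟨mem_insert_self _ _, h⟩
    rw [← h7] at this
    simp only [mem_biUnion, mem_sdiff] at this
    obtain ⟨i, _, h8, _⟩ := this
    exact hgA i h8
  -- elements of `S` are spanned by `A i ∩ S`
  have span : ∀ i (T : Finset γ), A i ∩ S ⊆ T → T ⊆ insert g M → ∀ b ∈ S, v i (insert b T) = v i T := by
    intro i T hT hTM b hb
    by_cases hbT : b ∈ T
    · rw [insert_eq_of_mem hbT]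
    have s1 := (hv i).2.2.1 (A i ∩ S) T hT hTM b (hS hb) hbT
    have s2 := mr_mono (hv i) (insert_subset hb inter_subset_right : insert b (A i ∩ S) ⊆ S) hS
    have s3 := mr_indep_subset (hv i) (inter_subset_left : A i ∩ S ⊆ A i) (hAM i) (hnr i)
    have s4 := mr_mono (hv i) (subset_insert b T) (insert_subset (hS hb) hTM)
    have := h6 i
    omega
  have hF : ∀ i b, b ∈ S → ¬ FSet (insert g M) (v i) (A i) b := by
    rintro i b hb ⟨_, _, h⟩
    rw [span i (A i) inter_subset_left (hAM i) b hb] at h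
    omega
  rcases hhyp with ⟨i, hi⟩ | ⟨i, P, g', hP, -, hh, hFS, hl⟩
  · exact hF i g hgS hi
  · refine hF i g' (chain_back (S := fun a => a ∈ S) ?_ hgS P g' hP hh hl) hFS
    rintro a b ⟨ha, hb, k, hk⟩ hbS
    by_contra haS
    revert hk
    refine Fin.cases ?_ (fun k => ?_) k
    · rw [hAhat0]
      rintro ⟨h, -⟩
      rw [mem_singleton] at h
      exact haS (h ▸ hgS)
    · rw [hAhatS, hvstarS]
      rintro ⟨q1, q2, q3⟩
      have hba : b ≠ a := fun h => q2 (h ▸ q1)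
      rw [erase_insert_of_ne hba] at q3
      have hsub : A k ∩ S ⊆ (A k).erase a := by
        intro x hx
        rw [mem_inter] at hx
        exact mem_erase.2 ⟨fun h => haS (h ▸ hx.2), hx.1⟩
      rw [span k _ hsub ((erase_subset _ _).trans (hAM k)) b hbS, hnr k,
        mr_indep_subset (hv k) (erase_subset a (A k)) (hAM k) (hnr k)] at q3
      have := card_erase_add_one q1
      omega

end PAO

/-- If, after adding the dummy agent `0` owning the new good `g`, `g` gives some agent positive
marginal value or a nondegenerate exchange-graph path reaches `g` from some `F_i(Â_i)`, then
exactly one agent's bundle grows by one good and all other bundles keep their size. -/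
theorem pathAddsOne {γ : Type} [DecidableEq γ] {n : ℕ} (M : Finset γ)
    (g : γ) (hg : g ∉ M)
    (w : Fin n → ℝ) (hw : ∀ i, 0 < w i)
    (v : Fin n → Finset γ → ℕ) (hv : ∀ i, MatroidRank (insert g M) (v i))
    (f : ℕ → EReal) (hf : StrictMono f) (hftop : ∀ k, f k ≠ ⊤)
    (hconc : ∀ k : ℕ, f (k + 2) + f k ≤ f (k + 1) + f (k + 1))
    (A A' : Fin n → Finset γ)
    (hA : IsRfTie n M w v f A) (hA' : IsRfTie n (insert g M) w v f A')
    (w0 : ℝ) (hw0 : 0 < w0)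
    (vstar : Fin (n + 1) → Finset γ → ℕ)
    (hvstar0 : vstar 0 = fun S => if g ∈ S then 1 else 0)
    (hvstarS : ∀ i : Fin n, vstar i.succ = v i)
    (Ahat : Fin (n + 1) → Finset γ)
    (hAhat0 : Ahat 0 = {g}) (hAhatS : ∀ i : Fin n, Ahat i.succ = A i)
    (hhyp : (∃ i : Fin n, FSet (insert g M) (v i) (A i) g) ∨
      ∃ (i : Fin n) (P : List γ) (g' : γ),
        P.Chain' (ExEdge (n + 1) (insert g M) vstar Ahat) ∧ 2 ≤ P.length ∧
        P.head? = some g' ∧ FSet (insert g M) (v i) (A i) g' ∧ P.getLast? = some g) :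
    ∃ z : Fin n, (A' z).card = (A z).card + 1 ∧
      ∀ y : Fin n, y ≠ z → (A' y).card = (A y).card := by
  have hvg : MatroidRank (insert g M) (fun S => if g ∈ S then 1 else 0) := by
    refine ⟨?_, ?_, ?_, ?_⟩
    · intro S _ a _ _
      simp only [mem_insert]
      grind
    · intro S T hST _
      by_cases h : g ∈ S
      · simp [h, hST h]
      · simp [h]
    · intro S T hST _ a _ _
      have := @hST g
      simp only [mem_insert]
      grind
    · simp
  have hrs : ∀ i, MatroidRank (insert g M) (vstar i) := by
    intro i
    refine Fin.cases ?_ (fun i => ?_) i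
    · rw [hvstar0]; exact hvg
    · rw [hvstarS]; exact hv i
  have hAM : ∀ i, A i ⊆ insert g M := fun i => (hA.1.1.1 i).trans (subset_insert _ _)
  have hgA : ∀ i, g ∉ A i := fun i h => hg (hA.1.1.1 i h)
  have hnr : ∀ i, v i (A i) = (A i).card := hA.2.2
  have hnr' : ∀ i, v i (A' i) = (A' i).card := hA'.2.2
  obtain ⟨i0, hi0⟩ := PAO.path_inc M g hg v hv A hAM hgA hA.1.1.2 hnr vstar hvstar0 hvstarS Ahat
    hAhat0 hAhatS hhyp
  -- optimality
  have hoA : ∀ B, IsAlloc n M B → PAO.Phi w f (fun i => v i (B i)) ≤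
      PAO.Phi w f (fun i => (A i).card) := by
    intro B hB
    have := PAO.optimal hw hf hftop hA hB
    simpa only [hnr] using this
  have hoA' : ∀ B, IsAlloc n (insert g M) B → PAO.Phi w f (fun i => v i (B i)) ≤
      PAO.Phi w f (fun i => (A' i).card) := by
    intro B hB
    have := PAO.optimal hw hf hftop hA' hB
    simpa only [hnr'] using this
  -- feasibility in the extended instance
  have feas : ∀ b : Fin (n + 1) → ℤ, PAO.InP (PAO.rho (insert g M) vstar) b → (∀ i, 0 ≤ b i) →
      ∃ B : Fin (n + 1) → Finset γ, (∀ i, B i ⊆ insert g M) ∧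
        (∀ i j, i ≠ j → Disjoint (B i) (B j)) ∧
        ∀ i, vstar i (B i) = (b i).toNat ∧ (B i).card = (b i).toNat := by
    intro b hb hb0
    apply PAO.alloc_of_inP hrs
    have : (fun i => (((b i).toNat : ℕ) : ℤ)) = b := by
      funext i; exact Int.toNat_of_nonneg (hb0 i)
    rw [this]; exact hb
  have O0 : ∀ (b : Fin (n + 1) → ℤ) (c : Fin n → ℕ),
      PAO.InP (PAO.rho (insert g M) vstar) b → 0 ≤ b 0 →
      (∀ i : Fin n, b i.succ = c i) → PAO.Phi w f c ≤ PAO.Phi w f (fun i => (A' i).card) := by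
    intro b c hb hb0 hbc
    obtain ⟨B, hB1, hB2, hB3⟩ := feas b hb (Fin.cases hb0 (fun i => by rw [hbc]; positivity))
    have := hoA' (fun i => B i.succ) ⟨fun i => hB1 _,
      fun i j hij => hB2 _ _ (fun h => hij (Fin.succ_injective _ h))⟩
    convert this using 2
    funext i
    rw [← hvstarS, (hB3 _).1, hbc]; simp
  have O1 : ∀ (b : Fin (n + 1) → ℤ) (c : Fin n → ℕ),
      PAO.InP (PAO.rho (insert g M) vstar) b → b 0 = 1 →
      (∀ i : Fin n, b i.succ = c i) → PAO.Phi w f c ≤ PAO.Phi w f (fun i => (A i).card) := by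
    intro b c hb hb0 hbc
    obtain ⟨B, hB1, hB2, hB3⟩ := feas b hb
      (Fin.cases (by rw [hb0]; norm_num) (fun i => by rw [hbc]; positivity))
    have hg0 : g ∈ B 0 := by
      by_contra hcon
      have := (hB3 0).1
      rw [hb0, hvstar0] at this
      simp [hcon] at this
    have := hoA (fun i => B i.succ) ⟨fun i => ?_,
      fun i j hij => hB2 _ _ (fun h => hij (Fin.succ_injective _ h))⟩
    · convert this using 2
      funext i
      rw [← hvstarS, (hB3 _).1, hbc]; simp
    · intro a ha
      rcases mem_insert.1 (hB1 _ ha) with rfl | h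
      · exact absurd ha (disjoint_left.1 (hB2 0 i.succ (Fin.succ_ne_zero i).symm) hg0)
      · exact h
  -- some agent strictly gains
  have hex : ∃ i, (A i).card < (A' i).card := by
    by_contra hcon
    push Not at hcon
    have e : ((fun i => ((A i).card : ℤ)) + Pi.single i0 1) =
        fun i => ((Function.update (fun i => (A i).card) i0 ((A i0).card + 1) i : ℕ) : ℤ) := by
      funext i
      by_cases h : i = i0
      · subst h; simp
      · simp [h]
    rw [e] at hi0
    obtain ⟨B, hB1, hB2, hB3⟩ := PAO.alloc_of_inP hv _ hi0
    have h1 := hoA' B ⟨hB1, hB2⟩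
    simp only [hB3] at h1
    have h2 := PAO.Phi_succ_lt hw hf hftop i0 (fun i => (A i).card)
    have h3 : PAO.Phi w f (fun i => (A' i).card) ≤ PAO.Phi w f (fun i => (A i).card) :=
      sum_le_sum fun i _ =>
        monotone_nat_of_le_succ (fun k => (PAO.phi_lt hw hf hftop i k).le) (hcon i)
    exact absurd (h2.trans_le (h1.trans h3)) (lt_irrefl _)
  obtain ⟨i, hi⟩ := hex
  -- the two points of the extended polymatroid
  obtain ⟨y, hy0, hyS, hyP⟩ : ∃ y : Fin (n + 1) → ℤ, y 0 = 1 ∧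
      (∀ i : Fin n, y i.succ = (A i).card) ∧ PAO.InP (PAO.rho (insert g M) vstar) y := by
    refine ⟨fun i => (Ahat i).card, by simp [hAhat0], fun i => by simp [hAhatS], ?_⟩
    apply PAO.inP_of_alloc hrs
    · refine Fin.cases (by simp [hAhat0]) (fun i => by rw [hAhatS]; exact hAM i)
    · intro a b
      refine Fin.cases ?_ (fun a => ?_) a <;> refine Fin.cases ?_ (fun b => ?_) b
      · simp
      · intro _; simpa [hAhat0, hAhatS] using hgA b
      · intro _; simpa [hAhat0, hAhatS] using hgA a
      · intro hab
        rw [hAhatS, hAhatS]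
        exact hA.1.1.2 a b (fun h => hab (by rw [h]))
    · refine Fin.cases (by simp [hAhat0, hvstar0]) (fun i => by rw [hAhatS, hvstarS]; exact hnr i)
  obtain ⟨x, hx0, hxS, hxP⟩ : ∃ x : Fin (n + 1) → ℤ, x 0 = 0 ∧
      (∀ i : Fin n, x i.succ = (A' i).card) ∧ PAO.InP (PAO.rho (insert g M) vstar) x := by
    refine ⟨fun i => ((Fin.cons ∅ A' : Fin (n + 1) → Finset γ) i).card, by simp, by simp, ?_⟩
    apply PAO.inP_of_alloc hrs
    · refine Fin.cases (by simp) (fun i => by simpa using hA'.1.1.1 i)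
    · intro a b
      refine Fin.cases ?_ (fun a => ?_) a <;> refine Fin.cases ?_ (fun b => ?_) b
      · simp
      · simp
      · simp
      · intro hab
        simpa using hA'.1.1.2 a b (fun h => hab (by rw [h]))
    · refine Fin.cases (by simp [hvstar0]) (fun i => by simpa [hvstarS] using hnr' i)
  rcases PAO.exchange (PAO.rho_submod hrs) hxP hyP i.succ (by rw [hyS, hxS]; exact_mod_cast hi)
    with h | ⟨j, hj, h1, h2⟩
  · exfalso
    have h2 := PAO.Phi_succ_lt hw hf hftop i (fun i => (A i).card)
    refine absurd (O1 _ (Function.update (fun i => (A i).card) i ((A i).card + 1)) h ?_ ?_)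
      (not_le.2 h2)
    · simp [hy0, (Fin.succ_ne_zero i).symm]
    · intro l
      by_cases hl : l = i
      · subst hl; simp [hyS]
      · simp [hyS, hl]
  · revert hj h1 h2
    refine Fin.cases ?_ (fun j => ?_) j
    · intro _ h1 h2
      have p1 := O1 _ (Function.update (fun i => (A' i).card) i ((A' i).card - 1)) h1
        (by simp [hx0, (Fin.succ_ne_zero i).symm]) (by
          intro l
          by_cases hl : l = i
          · subst hl
            simp [hxS, Fin.succ_ne_zero]; omega
          · simp [hxS, hl, Fin.succ_ne_zero])
      have p2 := O0 _ (Function.update (fun i => (A i).card) i ((A i).card + 1)) h2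
        (by simp [hy0, (Fin.succ_ne_zero i).symm]) (by
          intro l
          by_cases hl : l = i
          · subst hl
            simp [hyS, Fin.succ_ne_zero]
          · simp [hyS, hl, Fin.succ_ne_zero])
      have p3 := PAO.Phi_exch hw hf hftop hconc (fun i => (A' i).card) (fun i => (A i).card)
        (Function.update (fun i => (A' i).card) i ((A' i).card - 1))
        (Function.update (fun i => (A i).card) i ((A i).card + 1)) (by
          intro l
          by_cases hl : l = i
          · subst hl; right; left; simp; omega
          · left; simp [hl])
      have p4 := le_of_add_le_add_left
        (((add_comm _ _).le.trans p3).trans (add_le_add_left p1 _))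
      have p5 := PAO.Phi_inj w f (le_antisymm p2 p4)
      refine ⟨i, ?_, fun l hl => ?_⟩
      · have := congrFun p5 i; simpa using this.symm
      · have := congrFun p5 l; simpa [hl] using this.symm
    · intro hj h1 h2
      rw [hxS, hyS] at hj
      have hj : (A' j).card < (A j).card := by exact_mod_cast hj
      have hij : i ≠ j := by rintro rfl; omega
      have p1 := O0 _ (Function.update (Function.update (fun i => (A' i).card) i
          ((A' i).card - 1)) j ((A' j).card + 1)) h1
        (by simp [hx0, (Fin.succ_ne_zero _).symm]) (by
          intro l
          by_cases hl : l = i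
          · subst hl
            simp [hxS, hij]; omega
          · by_cases hl' : l = j
            · subst hl'; simp [hxS, hl]
            · simp [hxS, hl, hl'])
      have p2 := O1 _ (Function.update (Function.update (fun i => (A i).card) i
          ((A i).card + 1)) j ((A j).card - 1)) h2
        (by simp [hy0, (Fin.succ_ne_zero _).symm]) (by
          intro l
          by_cases hl : l = i
          · subst hl
            simp [hyS, hij]
          · by_cases hl' : l = j
            · subst hl'; simp [hyS, hl]; omega
            · simp [hyS, hl, hl'])
      have p3 := PAO.Phi_exch hw hf hftop hconc (fun i => (A' i).card) (fun i => (A i).card)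
        (Function.update (Function.update (fun i => (A' i).card) i
          ((A' i).card - 1)) j ((A' j).card + 1))
        (Function.update (Function.update (fun i => (A i).card) i
          ((A i).card + 1)) j ((A j).card - 1)) (by
          intro l
          by_cases hl : l = i
          · subst hl; right; left; simp [hij]; omega
          · by_cases hl' : l = j
            · subst hl'; right; right; simp; omega
            · left; simp [hl, hl'])
      have p4 := le_of_add_le_add_right (p3.trans (add_le_add_right p2 _))
      have p5 := congrFun (PAO.Phi_inj w f (le_antisymm p1 p4)) i
      simp [hij] at p5
      omega
end
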